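/- arXiv:2406.12451 — 2 statements merged into one kernel-verified Lean document; each statement's English description precedes it below -/
import Mathlib

section
/- There exist positive constants B_0 and A_0 = A_0(λ) such that for any B ≥ B_0 and any sequence A = A(n) with A_0 ≤ A and A = o(n^{2/3}), and for all sufficiently large n, P(G_{2L−1}(B)^c) = P(t_{2L−1} > B L T^{1/2}) ≤ exp(−c A^{3/2}) for some positive constant c = c(B). -/
/-!
Statement 4 (Proposition `rub` for `G(n,p)`): there exist positive constants `B₀` and
`A₀ = A₀(λ)` such that for any `B ≥ B₀` and any sequence `A = A(n)` with `A₀ ≤ A` and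
`A = o(n^{2/3})`, for all sufficiently large `n`,
`P(t_{2L-1} > B L T^{1/2}) ≤ exp(-c A^{3/2})` for some constant `c = c(B) > 0`.
-/

open MeasureTheory Filter Asymptotics ProbabilityTheory

noncomputable section

def bernoulliBool (p : ℝ) : Measure Bool :=
  (Real.toNNReal p) • Measure.dirac true + (Real.toNNReal (1 - p)) • Measure.dirac false

def erMeasure (n : ℕ) (p : ℝ) : Measure (Sym2 (Fin n) → Bool) :=
  Measure.pi fun _ => bernoulliBool p

def pER (n : ℕ) (lam : ℝ) : ℝ := (1 + lam * (n : ℝ) ^ (-(1 / 3 : ℝ))) / n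

/-- One step of the exploration process (Algorithm 1).  The state records the pair
(set of active vertices, set of explored vertices); unseen vertices are the rest. -/
def erStep {n : ℕ} (ω : Sym2 (Fin n) → Bool)
    (st : Finset (Fin n) × Finset (Fin n)) : Finset (Fin n) × Finset (Fin n) :=
  if hA : st.1.Nonempty then
    let u := st.1.min' hA
    let U := Finset.univ \ (st.1 ∪ st.2)
    ((st.1.erase u) ∪ U.filter fun v => ω s(u, v) = true, insert u st.2)
  else
    let U := Finset.univ \ (st.1 ∪ st.2)
    if hU : U.Nonempty then
      let u := U.min' hU
      ((U.erase u).filter fun v => ω s(u, v) = true, insert u st.2)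
    else st

/-- The state of the exploration process at time `t`; at time `0` the first vertex is
active and all other vertices are unseen. -/
def erState {n : ℕ} (ω : Sym2 (Fin n) → Bool) : ℕ → Finset (Fin n) × Finset (Fin n)
  | 0 => (Finset.univ.filter fun v : Fin n => (v : ℕ) = 0, ∅)
  | t + 1 => erStep ω (erState ω t)

/-- `Y t`, the number of active vertices at the end of step `t`. -/
def erY {n : ℕ} (ω : Sym2 (Fin n) → Bool) (t : ℕ) : ℕ := (erState ω t).1.card

/-- `η t`, the number of unseen vertices becoming active at step `t`. -/
def erEta {n : ℕ} (ω : Sym2 (Fin n) → Bool) (t : ℕ) : ℕ :=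
  ((erState ω t).1 \ (erState ω (t - 1)).1).card

/-- The hitting times `t_i`: `t_0 = 0` and `t_i = min {t > t_{i-1} : Y_t = 0}`. -/
def erHit {n : ℕ} (ω : Sym2 (Fin n) → Bool) : ℕ → ℕ
  | 0 => 0
  | i + 1 => sInf {t | erHit ω i < t ∧ erY ω t = 0}

/-- The filtration of the exploration process: `F t` is the σ-algebra generated by the
information revealed by the exploration up to time `t` (the history of states). -/
def erF (n : ℕ) (t : ℕ) : MeasurableSpace (Sym2 (Fin n) → Bool) :=
  MeasurableSpace.comap (fun ω => fun s : Fin (t + 1) => erState ω s) ⊤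

/-- The σ-algebra associated with the random time `τ` and the filtration `F`
(for a stopping time this is the usual stopped σ-algebra). -/
def sigmaAt {Ω : Type*} (F : ℕ → MeasurableSpace Ω) (τ : Ω → ℕ) : MeasurableSpace Ω :=
  MeasurableSpace.generateFrom {s | ∀ t, MeasurableSet[F t] (s ∩ {ω | τ ω ≤ t})}

/-- `T = ⌈n^{2/3}/A⌉`. -/
def Tof (n : ℕ) (a : ℝ) : ℕ := Nat.ceil ((n : ℝ) ^ ((2 : ℝ) / 3) / a)

/-- `L = ⌊n/(2T)⌋`. -/
def Lof (n : ℕ) (a : ℝ) : ℕ := n / (2 * Tof n a)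

/-- The number of unseen vertices which become active when one step of the exploration is made
from the state `st`. -/
def erNew {n : ℕ} (ω : Sym2 (Fin n) → Bool) (st : Finset (Fin n) × Finset (Fin n)) : ℕ :=
  if hA : st.1.Nonempty then
    ((Finset.univ \ (st.1 ∪ st.2)).filter fun v => ω s(st.1.min' hA, v) = true).card
  else
    if hU : (Finset.univ \ (st.1 ∪ st.2)).Nonempty then
      (((Finset.univ \ (st.1 ∪ st.2)).erase ((Finset.univ \ (st.1 ∪ st.2)).min' hU)).filter
        fun v => ω s((Finset.univ \ (st.1 ∪ st.2)).min' hU, v) = true).card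
    else 0

/-- The number of unseen vertices which become active during `k` steps of the exploration started
from the state `st`. -/
def erTotal {n : ℕ} (ω : Sym2 (Fin n) → Bool) (st : Finset (Fin n) × Finset (Fin n)) (k : ℕ) :
    ℕ :=
  ∑ j ∈ Finset.range k, erNew ω ((erStep ω)^[j] st)

lemma erTotal_succ {n : ℕ} (ω : Sym2 (Fin n) → Bool) (st : Finset (Fin n) × Finset (Fin n))
    (k : ℕ) : erTotal ω st (k + 1) = erNew ω st + erTotal ω (erStep ω st) k := by
  simp only [erTotal, Finset.sum_range_succ', Function.iterate_succ_apply,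
    Function.iterate_zero_apply]
  exact add_comm _ _

/-- A step of the exploration either does nothing, because all vertices are explored, or explores
one vertex `u`, looking only at the edges between `u` and a set `W` of unexplored vertices. -/
lemma erStep_cases {n : ℕ} (st : Finset (Fin n) × Finset (Fin n)) (hd : Disjoint st.1 st.2) :
    (st.2 = Finset.univ ∧ ∀ ω, erStep ω st = st ∧ erNew ω st = 0) ∨
    ∃ (u : Fin n) (W R : Finset (Fin n)), u ∉ st.2 ∧ u ∉ W ∧ Disjoint W st.2 ∧ u ∉ R ∧
      Disjoint R st.2 ∧ R.card + 1 ≤ st.1.card + (if st.1.card = 0 then 1 else 0) ∧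
      ∀ ω, erStep ω st = (R ∪ W.filter (fun v => ω s(u, v) = true), insert u st.2) ∧
        erNew ω st = (W.filter fun v => ω s(u, v) = true).card := by
  by_cases hA : st.1.Nonempty
  · right
    have hu := st.1.min'_mem hA
    refine ⟨st.1.min' hA, Finset.univ \ (st.1 ∪ st.2), st.1.erase (st.1.min' hA),
      Finset.disjoint_left.1 hd hu, by simp [hu], ?_, by simp, ?_, ?_, fun ω => ?_⟩
    · exact Finset.disjoint_left.2 fun x hx => by simp at hx; tauto
    · exact hd.mono_left (Finset.erase_subset _ _)
    · rw [Finset.card_erase_add_one hu]; omega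
    · simp [erStep, erNew, hA]
  · by_cases hU : (Finset.univ \ (st.1 ∪ st.2)).Nonempty
    · right
      have hu := (Finset.univ \ (st.1 ∪ st.2)).min'_mem hU
      refine ⟨(Finset.univ \ (st.1 ∪ st.2)).min' hU,
        (Finset.univ \ (st.1 ∪ st.2)).erase ((Finset.univ \ (st.1 ∪ st.2)).min' hU), ∅,
        ?_, by simp, ?_, by simp, by simp, ?_, fun ω => ?_⟩
      · rw [Finset.mem_sdiff, Finset.mem_union] at hu; tauto
      · exact Finset.disjoint_left.2 fun x hx => by simp at hx; tauto
      · rw [Finset.not_nonempty_iff_eq_empty] at hA; simp [hA]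
      · simp only [erStep, erNew, hA, hU, dif_pos, dif_neg, not_false_iff, Finset.empty_union,
          and_self]
    · left
      refine ⟨?_, fun ω => ?_⟩
      · rw [Finset.not_nonempty_iff_eq_empty] at hA hU
        simpa [hA, Finset.sdiff_eq_empty_iff_subset, Finset.univ_subset_iff] using hU
      · simp only [erStep, erNew, hA, hU, dif_neg, not_false_iff, and_self]

lemma disjoint_union_filter_insert {n : ℕ} {E W R : Finset (Fin n)} {u : Fin n} (hW : u ∉ W)
    (hWE : Disjoint W E) (hR : u ∉ R) (hRE : Disjoint R E) (p : Fin n → Prop) [DecidablePred p] :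
    Disjoint (R ∪ W.filter p) (insert u E) := by
  rw [Finset.disjoint_insert_right, Finset.disjoint_union_left]
  exact ⟨by simp [hW, hR], hRE, hWE.mono_left (Finset.filter_subset _ _)⟩

/-- The exploration started from a state only looks at edges avoiding the explored vertices of that
state. -/
lemma erTotal_congr {n : ℕ} (k : ℕ) (st : Finset (Fin n) × Finset (Fin n))
    (hd : Disjoint st.1 st.2) (ω ω' : Sym2 (Fin n) → Bool)
    (h : ∀ e : Sym2 (Fin n), (∀ v ∈ e, v ∉ st.2) → ω e = ω' e) :
    erTotal ω st k = erTotal ω' st k := by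
  induction k generalizing st with
  | zero => simp [erTotal]
  | succ k ih =>
    rw [erTotal_succ, erTotal_succ]
    rcases erStep_cases st hd with ⟨-, hst⟩ | ⟨u, W, R, hu, hW, hWE, hR, hRE, -, hst⟩
    · rw [(hst ω).1, (hst ω').1, (hst ω).2, (hst ω').2, ih st hd h]
    · have hf : W.filter (fun v => ω s(u, v) = true) = W.filter fun v => ω' s(u, v) = true := by
        refine Finset.filter_congr fun v hv => ?_
        rw [h s(u, v)]
        intro w hw
        rcases Sym2.mem_iff.1 hw with rfl | rfl
        · exact hu
        · exact Finset.disjoint_left.1 hWE hv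
      rw [(hst ω).1, (hst ω').1, (hst ω).2, (hst ω').2, hf]
      congr 1
      refine ih _ (disjoint_union_filter_insert hW hWE hR hRE _) fun e he => h e fun v hv => ?_
      exact fun hv' => he v hv (Finset.mem_insert_of_mem hv')

lemma erState_eq_iterate {n : ℕ} (ω : Sym2 (Fin n) → Bool) (t : ℕ) :
    erState ω t = (erStep ω)^[t] (erState ω 0) := by
  induction t with
  | zero => rfl
  | succ t ih => rw [Function.iterate_succ_apply', ← ih]; rfl

lemma erTotal_state_succ {n : ℕ} (ω : Sym2 (Fin n) → Bool) (t : ℕ) :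
    erTotal ω (erState ω 0) (t + 1) = erTotal ω (erState ω 0) t + erNew ω (erState ω t) := by
  rw [erTotal, Finset.sum_range_succ, ← erState_eq_iterate]; rfl

lemma erState_disjoint {n : ℕ} (ω : Sym2 (Fin n) → Bool) (t : ℕ) :
    Disjoint (erState ω t).1 (erState ω t).2 := by
  induction t with
  | zero => simp [erState]
  | succ t ih =>
    rw [erState]
    rcases erStep_cases _ ih with ⟨-, hst⟩ | ⟨u, W, R, hu, hW, hWE, hR, hRE, -, hst⟩
    · rwa [(hst ω).1]
    · rw [(hst ω).1]
      exact disjoint_union_filter_insert hW hWE hR hRE _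

lemma min_le_card_explored {n : ℕ} (ω : Sym2 (Fin n) → Bool) (t : ℕ) :
    min t n ≤ (erState ω t).2.card := by
  induction t with
  | zero => simp
  | succ t ih =>
    rw [erState]
    rcases erStep_cases _ (erState_disjoint ω t) with ⟨h, hst⟩ | ⟨u, W, R, hu, -, -, -, -, -, hst⟩
    · rw [(hst ω).1, h]; simp
    · rw [(hst ω).1, Finset.card_insert_of_notMem hu]; omega

/-- The number of seen vertices is controlled by the number of vertices that became active and the
number of previous visits of `Y` to zero. -/
lemma card_seen_le {n : ℕ} (ω : Sym2 (Fin n) → Bool) (t : ℕ) :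
    (erState ω t).1.card + (erState ω t).2.card ≤
      1 + erTotal ω (erState ω 0) t + ((Finset.range t).filter fun s => erY ω s = 0).card := by
  induction t with
  | zero =>
    have : (Finset.univ.filter fun v : Fin n => (v : ℕ) = 0).card ≤ 1 :=
      Finset.card_le_one.2 fun a ha b hb => Fin.ext (by simp at ha hb; omega)
    simpa [erState, erTotal] using this
  | succ t ih =>
    have hY : ((Finset.range (t + 1)).filter fun s => erY ω s = 0).card =
        ((Finset.range t).filter fun s => erY ω s = 0).card +
          if (erState ω t).1.card = 0 then 1 else 0 := by
      rw [Finset.card_filter, Finset.card_filter, Finset.sum_range_succ]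
      rfl
    rw [hY, erTotal_state_succ]
    conv_lhs => rw [erState]
    rcases erStep_cases _ (erState_disjoint ω t) with ⟨h, hst⟩ | ⟨u, W, R, hu, -, -, -, -, hc, hst⟩
    · rw [(hst ω).1, (hst ω).2]; omega
    · rw [(hst ω).1, (hst ω).2, Finset.card_insert_of_notMem hu]
      have := Finset.card_union_le R (W.filter fun v => ω s(u, v) = true)
      simp only
      omega

lemma card_zeros_le_hit {n : ℕ} (ω : Sym2 (Fin n) → Bool) (k : ℕ) :
    ((Finset.Ioc 0 (erHit ω k)).filter fun s => erY ω s = 0).card ≤ k := by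
  induction k with
  | zero => simp [erHit]
  | succ k ih =>
    refine (Finset.card_le_card (t := insert (erHit ω (k + 1))
      ((Finset.Ioc 0 (erHit ω k)).filter fun s => erY ω s = 0)) fun s hs => ?_).trans
      ((Finset.card_insert_le _ _).trans (Nat.succ_le_succ ih))
    simp only [Finset.mem_filter, Finset.mem_Ioc, Finset.mem_insert] at hs ⊢
    obtain ⟨⟨h0, h1⟩, h2⟩ := hs
    by_cases h : s ≤ erHit ω k
    · exact Or.inr ⟨⟨h0, h⟩, h2⟩
    · exact Or.inl (le_antisymm h1 (Nat.sInf_le ⟨not_le.1 h, h2⟩))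

lemma card_zeros_le_of_lt_hit {n : ℕ} (ω : Sym2 (Fin n) → Bool) (k m : ℕ)
    (h : m < erHit ω (k + 1)) : ((Finset.Ioc 0 m).filter fun s => erY ω s = 0).card ≤ k := by
  refine (Finset.card_le_card fun s hs => ?_).trans (card_zeros_le_hit ω k)
  simp only [Finset.mem_filter, Finset.mem_Ioc] at hs ⊢
  obtain ⟨⟨h0, h1⟩, h2⟩ := hs
  refine ⟨⟨h0, ?_⟩, h2⟩
  by_contra hlt
  have : erHit ω (k + 1) ≤ s := Nat.sInf_le ⟨not_le.1 hlt, h2⟩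
  omega

/-- If the `(k + 1)`-th component is not yet completed at time `m`, then many vertices became
active by time `m`. -/
lemma le_erTotal_of_lt_hit {n : ℕ} (ω : Sym2 (Fin n) → Bool) (k m : ℕ) (hn : 0 < n) (hm : m ≤ n)
    (h : m < erHit ω (k + 1)) : m ≤ erTotal ω (erState ω 0) m + (k + 1) := by
  have h0 : erY ω 0 ≠ 0 := by
    have : (⟨0, hn⟩ : Fin n) ∈ (erState ω 0).1 := by simp [erState]
    exact (Finset.card_pos.2 ⟨_, this⟩).ne'
  have h1 : ((Finset.range m).filter fun s => erY ω s = 0).card ≤ k := by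
    refine (Finset.card_le_card fun s hs => ?_).trans (card_zeros_le_of_lt_hit ω k m h)
    simp only [Finset.mem_filter, Finset.mem_Ioc, Finset.mem_range] at hs ⊢
    refine ⟨⟨Nat.pos_of_ne_zero ?_, hs.1.le⟩, hs.2⟩
    rintro rfl
    exact h0 hs.2
  have h2 := min_le_card_explored ω m
  have h3 := card_seen_le ω m
  omega

/-- Under a product measure on `ι → Bool`, functions of disjoint sets of coordinates are
independent. -/
lemma lintegral_pi_mul_of_disjoint {ι : Type*} [Fintype ι] [DecidableEq ι] (ν : ι → Measure Bool)
    [∀ i, IsProbabilityMeasure (ν i)] {S S' : Finset ι} (hS : Disjoint S S')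
    {f g : (ι → Bool) → ENNReal}
    (hf : ∀ ω ω' : ι → Bool, (∀ i ∈ S, ω i = ω' i) → f ω = f ω')
    (hg : ∀ ω ω' : ι → Bool, (∀ i ∈ S', ω i = ω' i) → g ω = g ω') :
    ∫⁻ ω, f ω * g ω ∂Measure.pi ν = (∫⁻ ω, f ω ∂Measure.pi ν) * ∫⁻ ω, g ω ∂Measure.pi ν := by
  have key : ∀ (V : Finset ι) (h : (ι → Bool) → ENNReal),
      (∀ ω ω' : ι → Bool, (∀ i ∈ V, ω i = ω' i) → h ω = h ω') →
      h = (fun x : V → Bool => h fun i => if hi : i ∈ V then x ⟨i, hi⟩ else false) ∘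
        fun (ω : ι → Bool) (i : V) => ω i := by
    intro V h hV
    funext ω
    exact hV _ _ fun i hi => by simp [hi]
  have hind : iIndepFun (fun (i : ι) (ω : ι → Bool) => ω i) (Measure.pi ν) :=
    iIndepFun_pi (X := fun _ => id) fun _ => aemeasurable_id
  have h2 := (hind.indepFun_finset S S' hS fun i => measurable_pi_apply i).comp
    (φ := fun x : S → Bool => f fun i => if hi : i ∈ S then x ⟨i, hi⟩ else false)
    (ψ := fun x : S' → Bool => g fun i => if hi : i ∈ S' then x ⟨i, hi⟩ else false)
    (Measurable.of_discrete) (Measurable.of_discrete)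
  rw [← key S f hf, ← key S' g hg] at h2
  exact lintegral_mul_eq_lintegral_mul_lintegral_of_indepFun'' (Measurable.of_discrete).aemeasurable
    (Measurable.of_discrete).aemeasurable h2

lemma isProbabilityMeasure_bernoulliBool {p : ℝ} (h0 : 0 ≤ p) (h1 : p ≤ 1) :
    IsProbabilityMeasure (bernoulliBool p) := by
  refine ⟨?_⟩
  simp only [bernoulliBool, Measure.add_apply, Measure.smul_apply, measure_univ]
  rw [ENNReal.smul_def, ENNReal.smul_def, smul_eq_mul, smul_eq_mul, mul_one, mul_one,
    ← ENNReal.coe_add, ← Real.toNNReal_add h0 (by linarith)]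
  simp

/-- The generating function at `z` of a Bernoulli variable. -/
def bernoulliGF (p : ℝ) (z : ENNReal) : ENNReal := ∫⁻ b, (if b = true then z else 1) ∂bernoulliBool p

lemma bernoulliGF_eq (p : ℝ) (z : ENNReal) :
    bernoulliGF p z = ENNReal.ofReal p * z + ENNReal.ofReal (1 - p) := by
  rw [bernoulliGF, bernoulliBool, lintegral_add_measure, lintegral_smul_measure,
    lintegral_smul_measure, lintegral_dirac, lintegral_dirac]
  simp [ENNReal.smul_def, ENNReal.ofReal]

lemma one_le_bernoulliGF {p : ℝ} (h0 : 0 ≤ p) (h1 : p ≤ 1) {z : ENNReal} (hz : 1 ≤ z) :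
    1 ≤ bernoulliGF p z := by
  have := isProbabilityMeasure_bernoulliBool h0 h1
  calc (1 : ENNReal) = ∫⁻ _, 1 ∂bernoulliBool p := by rw [lintegral_const, measure_univ, one_mul]
    _ ≤ _ := lintegral_mono fun b => by split_ifs <;> simp [hz]

lemma lintegral_pow_card_filter {n : ℕ} {p : ℝ} (h0 : 0 ≤ p) (h1 : p ≤ 1) (z : ENNReal) (u : Fin n)
    (W : Finset (Fin n)) :
    ∫⁻ ω, z ^ (W.filter fun v => ω s(u, v) = true).card ∂erMeasure n p =
      bernoulliGF p z ^ W.card := by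
  have := isProbabilityMeasure_bernoulliBool h0 h1
  induction W using Finset.induction_on with
  | empty => simp [erMeasure]
  | insert v W hv ih =>
    have hsplit : ∀ ω : Sym2 (Fin n) → Bool,
        z ^ ((insert v W).filter fun v => ω s(u, v) = true).card =
          (if ω s(u, v) = true then z else 1) *
            z ^ (W.filter fun v => ω s(u, v) = true).card := by
      intro ω
      rw [Finset.filter_insert]
      split_ifs with h
      · rw [Finset.card_insert_of_notMem (by simp [hv]), pow_succ']
      · rw [one_mul]
    simp_rw [hsplit]
    rw [Finset.card_insert_of_notMem hv, pow_succ', ← ih]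
    have hev : bernoulliGF p z = ∫⁻ ω, (if ω s(u, v) = true then z else 1) ∂erMeasure n p :=
      ((measurePreserving_eval (fun _ : Sym2 (Fin n) => bernoulliBool p)
        s(u, v)).lintegral_comp (f := fun b => if b = true then z else 1)
          Measurable.of_discrete).symm
    rw [hev]
    refine lintegral_pi_mul_of_disjoint _ (S := {s(u, v)}) (S' := W.image fun w => s(u, w))
      ?_ ?_ ?_
    · rw [Finset.disjoint_singleton_left, Finset.mem_image]
      rintro ⟨w, hw, he⟩
      rw [Sym2.congr_right] at he
      exact hv (he ▸ hw)
    · intro ω ω' h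
      rw [h s(u, v) (by simp)]
    · intro ω ω' h
      congr 2
      refine Finset.filter_congr fun w hw => ?_
      rw [h s(u, w) (Finset.mem_image_of_mem _ hw)]

/-- The number of vertices becoming active in `k` steps is stochastically dominated, in the sense of
generating functions, by a binomial variable. -/
lemma lintegral_pow_erTotal_le {n : ℕ} {p : ℝ} (h0 : 0 ≤ p) (h1 : p ≤ 1) {z : ENNReal}
    (hz : 1 ≤ z) (k : ℕ) (st : Finset (Fin n) × Finset (Fin n)) (hd : Disjoint st.1 st.2) :
    ∫⁻ ω, z ^ erTotal ω st k ∂erMeasure n p ≤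
      bernoulliGF p z ^ ∑ j ∈ Finset.range k, (n - (st.2.card + j + 1)) := by
  have := isProbabilityMeasure_bernoulliBool h0 h1
  have hb := one_le_bernoulliGF h0 h1 hz
  induction k generalizing st with
  | zero => simp [erTotal, erMeasure]
  | succ k ih =>
    rcases erStep_cases st hd with ⟨-, hst⟩ | ⟨u, W, R, hu, hW, hWE, hR, hRE, -, hst⟩
    · simp only [erTotal_succ, (hst _).1, (hst _).2, zero_add]
      refine (ih st hd).trans (pow_le_pow_right₀ hb ?_)
      rw [Finset.sum_range_succ]
      exact Nat.le_add_right _ _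
    · have hcard : W.card ≤ n - (st.2.card + 0 + 1) := by
        have hdis : Disjoint W (insert u st.2) := Finset.disjoint_insert_right.2 ⟨hW, hWE⟩
        have h3 := Finset.card_le_univ (W ∪ insert u st.2)
        rw [Finset.card_union_of_disjoint hdis, Finset.card_insert_of_notMem hu,
          Fintype.card_fin] at h3
        omega
      set D : ENNReal :=
        bernoulliGF p z ^ ∑ j ∈ Finset.range k, (n - ((insert u st.2).card + j + 1)) with hD
      have hsplit : ∀ ω : Sym2 (Fin n) → Bool, z ^ erTotal ω st (k + 1) =
          ∑ S ∈ W.powerset, (if W.filter (fun v => ω s(u, v) = true) = S then z ^ S.card else 0) *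
            z ^ erTotal ω (R ∪ S, insert u st.2) k := by
        intro ω
        rw [Finset.sum_eq_single_of_mem (W.filter fun v => ω s(u, v) = true)
          (Finset.mem_powerset.2 (Finset.filter_subset _ _))
          (fun S _ hS => by rw [if_neg hS.symm, zero_mul]),
          erTotal_succ, (hst ω).1, (hst ω).2, if_pos rfl, pow_add]
      have hfac : ∀ S ∈ W.powerset,
          ∫⁻ ω, (if W.filter (fun v => ω s(u, v) = true) = S then z ^ S.card else 0) *
            z ^ erTotal ω (R ∪ S, insert u st.2) k ∂erMeasure n p ≤
          (∫⁻ ω, (if W.filter (fun v => ω s(u, v) = true) = S then z ^ S.card else 0)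
            ∂erMeasure n p) * D := by
        intro S hS
        have hdS : Disjoint (R ∪ S) (insert u st.2) := by
          have := disjoint_union_filter_insert hW hWE hR hRE (· ∈ S)
          rwa [Finset.filter_mem_eq_inter, Finset.inter_eq_right.2 (Finset.mem_powerset.1 hS)]
            at this
        rw [erMeasure, lintegral_pi_mul_of_disjoint _ (S := Finset.univ.filter fun e => u ∈ e)
          (S' := Finset.univ.filter fun e => u ∉ e)
          (Finset.disjoint_filter_filter_not _ _ _)]
        · exact mul_le_mul_right (ih (R ∪ S, insert u st.2) hdS) _
        · intro ω ω' h
          have : W.filter (fun v => ω s(u, v) = true) = W.filter fun v => ω' s(u, v) = true :=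
            Finset.filter_congr fun w _ => by rw [h s(u, w) (by simp)]
          rw [this]
        · intro ω ω' h
          rw [erTotal_congr k (R ∪ S, insert u st.2) hdS ω ω' fun e he => h e ?_]
          simp only [Finset.mem_filter, Finset.mem_univ, true_and]
          exact fun hue => he u hue (Finset.mem_insert_self _ _)
      calc ∫⁻ ω, z ^ erTotal ω st (k + 1) ∂erMeasure n p
          = ∑ S ∈ W.powerset,
              ∫⁻ ω, (if W.filter (fun v => ω s(u, v) = true) = S then z ^ S.card else 0) *
                z ^ erTotal ω (R ∪ S, insert u st.2) k ∂erMeasure n p := by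
            simp_rw [hsplit]
            exact lintegral_finsetSum _ fun _ _ => Measurable.of_discrete
        _ ≤ ∑ S ∈ W.powerset,
              (∫⁻ ω, (if W.filter (fun v => ω s(u, v) = true) = S then z ^ S.card else 0)
                ∂erMeasure n p) * D := Finset.sum_le_sum hfac
        _ = (∫⁻ ω, z ^ (W.filter fun v => ω s(u, v) = true).card ∂erMeasure n p) * D := by
            rw [← Finset.sum_mul, ← lintegral_finsetSum _ fun _ _ => Measurable.of_discrete]
            congr 2
            funext ω
            rw [Finset.sum_ite_eq, if_pos (Finset.mem_powerset.2 (Finset.filter_subset _ _))]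
        _ = bernoulliGF p z ^ W.card * D := by rw [lintegral_pow_card_filter h0 h1]
        _ ≤ _ := by
            rw [hD, ← pow_add, Finset.card_insert_of_notMem hu, Finset.sum_range_succ', add_comm]
            refine pow_le_pow_right₀ hb (add_le_add (Finset.sum_le_sum fun j _ => ?_) hcard)
            omega

/-- Chernoff bound for the number of vertices becoming active in the first `m` steps. -/
lemma measure_lt_erHit_le {n m k : ℕ} {p θ : ℝ} (h0 : 0 ≤ p) (h1 : p ≤ 1) (hθ : 0 ≤ θ)
    (hn : 0 < n) (hm : m ≤ n) :
    erMeasure n p {ω | m < erHit ω (k + 1)} ≤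
      ENNReal.ofReal (Real.exp (p * (Real.exp θ - 1) * (n * m - m ^ 2 / 2) -
        θ * (m - (k + 1)))) := by
  have hz : (1 : ENNReal) ≤ ENNReal.ofReal (Real.exp θ) := by simpa using hθ
  have hexp := Real.add_one_le_exp θ
  have hbound := lintegral_pow_erTotal_le (n := n) h0 h1 hz m
    (Finset.univ.filter fun v : Fin n => (v : ℕ) = 0, ∅) (by simp)
  have hGF : bernoulliGF p (ENNReal.ofReal (Real.exp θ)) ≤
      ENNReal.ofReal (Real.exp (p * (Real.exp θ - 1))) := by
    rw [bernoulliGF_eq, ← ENNReal.ofReal_mul h0,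
      ← ENNReal.ofReal_add (by positivity) (by linarith)]
    refine ENNReal.ofReal_le_ofReal ?_
    linarith [Real.add_one_le_exp (p * (Real.exp θ - 1))]
  have hsum : ((∑ j ∈ Finset.range m, (n - (0 + j + 1)) : ℕ) : ℝ) ≤ n * m - (m : ℝ) ^ 2 / 2 := by
    clear hbound
    induction m with
    | zero => simp
    | succ m ih =>
      rw [Finset.sum_range_succ, Nat.cast_add, Nat.cast_sub (by omega)]
      have := ih (by omega)
      push_cast at this ⊢
      linarith
  set N := ∑ j ∈ Finset.range m, (n - (0 + j + 1)) with hN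
  have hmgf : ∫⁻ ω, ENNReal.ofReal (Real.exp θ) ^ erTotal ω (erState ω 0) m ∂erMeasure n p ≤
      ENNReal.ofReal (Real.exp (p * (Real.exp θ - 1) * (n * m - m ^ 2 / 2))) := by
    refine (hbound.trans (pow_le_pow_left₀ zero_le hGF _)).trans ?_
    rw [← ENNReal.ofReal_pow (Real.exp_pos _).le, ← Real.exp_nat_mul, Finset.card_empty, ← hN]
    refine ENNReal.ofReal_le_ofReal (Real.exp_le_exp.2 ?_)
    rw [mul_comm]
    exact mul_le_mul_of_nonneg_left hsum (mul_nonneg h0 (by linarith))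
  have hmarkov := mul_meas_ge_le_lintegral (μ := erMeasure n p)
    (f := fun ω => ENNReal.ofReal (Real.exp θ) ^ erTotal ω (erState ω 0) m)
    Measurable.of_discrete (ENNReal.ofReal (Real.exp (θ * (m - (k + 1)))))
  have hsub : {ω : Sym2 (Fin n) → Bool | m < erHit ω (k + 1)} ⊆
      {ω | ENNReal.ofReal (Real.exp (θ * (m - (k + 1)))) ≤
        ENNReal.ofReal (Real.exp θ) ^ erTotal ω (erState ω 0) m} := by
    intro ω hω
    have h := le_erTotal_of_lt_hit ω k m hn hm hω
    have h' : (m : ℝ) ≤ erTotal ω (erState ω 0) m + (k + 1) := by exact_mod_cast h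
    rw [Set.mem_ofPred_eq, ← ENNReal.ofReal_pow (Real.exp_pos _).le, ← Real.exp_nat_mul]
    refine ENNReal.ofReal_le_ofReal (Real.exp_le_exp.2 ?_)
    nlinarith
  rw [Real.exp_sub, ENNReal.ofReal_div_of_pos (Real.exp_pos _)]
  rw [ENNReal.le_div_iff_mul_le (Or.inl (by simp [Real.exp_pos]))
    (Or.inl ENNReal.ofReal_ne_top), mul_comm]
  exact (mul_le_mul_right (measure_mono hsub) _).trans (hmarkov.trans hmgf)

lemma mgf_exponent_le {n m p θ δ : ℝ} (hn : 0 < n) (hm0 : 0 ≤ m) (hmn : m ≤ n) (hδ : 0 ≤ δ)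
    (hp : p * n ≤ 1 + δ) (hθ0 : 0 < θ) (hθ1 : θ ≤ 1) :
    p * (Real.exp θ - 1) * (n * m - m ^ 2 / 2) ≤
      θ * (m - m ^ 2 / (2 * n)) + θ * (θ * m + 2 * (δ * m)) := by
  have hexp0 : 0 ≤ Real.exp θ - 1 := by linarith [Real.add_one_le_exp θ]
  have hexp : Real.exp θ - 1 ≤ θ + θ ^ 2 := by
    have h := Real.abs_exp_sub_one_sub_id_le (x := θ) (by rwa [abs_of_pos hθ0])
    linarith [le_abs_self (Real.exp θ - 1 - θ)]
  set r := m - m ^ 2 / (2 * n) with hr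
  have hr0 : 0 ≤ r := by
    have : m ^ 2 / (2 * n) ≤ m := by rw [div_le_iff₀ (by positivity)]; nlinarith
    linarith
  have hrm : r ≤ m := by
    have : 0 ≤ m ^ 2 / (2 * n) := by positivity
    linarith
  have h1 : p * (Real.exp θ - 1) * (n * m - m ^ 2 / 2) ≤ (1 + δ) * (θ + θ ^ 2) * r := by
    have : p * (Real.exp θ - 1) * (n * m - m ^ 2 / 2) = p * n * (Real.exp θ - 1) * r := by
      rw [hr]; field_simp
    rw [this]
    gcongr
  have h2 : (1 + δ) * (θ + θ ^ 2) * r ≤ θ * r + θ * (θ * m + 2 * (δ * m)) := by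
    have e1 : θ * θ * r ≤ θ * θ * m := by gcongr
    have e2 : δ * (θ + θ ^ 2) * r ≤ δ * (2 * θ) * m := by
      gcongr
      nlinarith
    nlinarith
  exact h1.trans h2

lemma chernoff_exponent_le {n m L T s x a w B Λ p θ k : ℝ} (hn : 0 < n) (hm0 : 0 ≤ m)
    (hmn : m ≤ n) (hL : 0 ≤ L) (hs : 1 ≤ s) (hsT : s ^ 2 = T) (hx : 0 < x) (hxn : x ^ 3 = n)
    (hΛ : 0 ≤ Λ) (ha : Λ ^ 2 ≤ a) (hwa : w ^ 2 = a ^ 3) (hB : 200 ≤ B)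
    (hTa : T * a ≤ 2 * x ^ 2) (hLT : n ≤ 4 * (L * T)) (hmL : m ≤ B * L * s)
    (hmL' : B * L * s ≤ 2 * m) (hp : p * n ≤ 1 + Λ / x) (hθ : θ = 1 / s)
    (hk : k ≤ 2 * L) :
    p * (Real.exp θ - 1) * (n * m - m ^ 2 / 2) - θ * (m - k) ≤ -(1 / 12 * w) := by
  have hs0 : 0 < s := by linarith
  have hT : 0 < T := by rw [← hsT]; positivity
  have ha0 : 0 ≤ a := (sq_nonneg Λ).trans ha
  have hθ0 : 0 < θ := by rw [hθ]; positivity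
  have hθ1 : θ ≤ 1 := by rw [hθ]; exact (div_le_one hs0).2 hs
  have h1 := mgf_exponent_le hn hm0 hmn (by positivity : 0 ≤ Λ / x) hp hθ0 hθ1
  have h3 : θ * m ≤ B * L := by
    rw [hθ, one_div_mul_eq_div, div_le_iff₀ hs0]; exact hmL
  have hΛs : Λ * s ≤ 2 * x := by
    refine abs_le_of_sq_le_sq' ?_ (by positivity) |>.2
    have : Λ ^ 2 * T ≤ a * T := by gcongr
    nlinarith [sq_nonneg x]
  have h4 : Λ / x * m ≤ 2 * (B * L) := by
    rw [div_mul_eq_mul_div, div_le_iff₀ hx]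
    calc Λ * m ≤ Λ * (B * L * s) := by gcongr
      _ = B * L * (Λ * s) := by ring
      _ ≤ B * L * (2 * x) := by gcongr
      _ = _ := by ring
  have h5 : B ^ 2 * L / 32 ≤ m ^ 2 / (2 * n) := by
    rw [le_div_iff₀ (by positivity)]
    have e1 : (B * L * s) ^ 2 ≤ (2 * m) ^ 2 := by gcongr
    have e2 : (B * L * s) ^ 2 = B ^ 2 * L * (L * T) := by rw [← hsT]; ring
    have e3 : B ^ 2 * L * n ≤ B ^ 2 * L * (4 * (L * T)) := by gcongr
    linarith
  have h6 : w ≤ 12 * (θ * L) := by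
    have e1 : (T * s * w) ^ 2 ≤ (3 * n) ^ 2 := by
      have e2 : (T * s * w) ^ 2 = (T * a) ^ 3 := by
        rw [mul_pow, mul_pow, hsT, hwa]; ring
      have e3 : (T * a) ^ 3 ≤ (2 * x ^ 2) ^ 3 := by gcongr
      calc (T * s * w) ^ 2 ≤ (2 * x ^ 2) ^ 3 := e2.trans_le e3
        _ = 8 * x ^ 6 := by ring
        _ ≤ 9 * x ^ 6 := by gcongr; norm_num
        _ = (3 * n) ^ 2 := by rw [← hxn]; ring
    have e4 : T * s * w ≤ 3 * n := abs_le_of_sq_le_sq' e1 (by positivity) |>.2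
    have e5 : T * (s * w) ≤ T * (12 * L) := by linarith
    have e6 : s * w ≤ 12 * L := le_of_mul_le_mul_left e5 hT
    rw [hθ, one_div_mul_eq_div, ← mul_div_assoc, le_div_iff₀ hs0]
    linarith
  have h7 : θ * (2 + 5 * B - B ^ 2 / 32) * L ≤ θ * (-1) * L := by
    have : 2 + 5 * B - B ^ 2 / 32 ≤ -1 := by nlinarith
    gcongr
  have h8 : θ * k ≤ θ * (2 * L) := by gcongr
  have h9 : θ * (θ * m + 2 * (Λ / x * m)) ≤ θ * (5 * (B * L)) := by gcongr; linarith
  have h10 : θ * (m - m ^ 2 / (2 * n)) ≤ θ * (m - B ^ 2 * L / 32) := by gcongr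
  linarith

theorem explored_by_time_bound_ER (lam : ℝ) :
    ∃ B₀ > (0 : ℝ), ∃ A₀ > (0 : ℝ), ∀ B ≥ B₀, ∃ c > (0 : ℝ), ∀ A : ℕ → ℝ,
      (∀ n, A₀ ≤ A n) →
      A =o[atTop] (fun n : ℕ => (n : ℝ) ^ ((2 : ℝ) / 3)) →
      ∀ᶠ n : ℕ in atTop,
        erMeasure n (pER n lam)
            {ω | B * (Lof n (A n) : ℝ) * Real.sqrt (Tof n (A n)) <
                  (erHit ω (2 * Lof n (A n) - 1) : ℝ)}
          ≤ ENNReal.ofReal (Real.exp (-(c * A n ^ ((3 : ℝ) / 2)))) := by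
  have hΛ1 : 1 ≤ |lam| + 1 := by linarith [abs_nonneg lam]
  refine ⟨200, by norm_num, (|lam| + 1) ^ 2, by positivity, fun B hB => ⟨1 / 12, by norm_num, ?_⟩⟩
  intro A hA ho
  have hB0 : 0 < B := by linarith
  have hx_ev : ∀ᶠ n : ℕ in atTop, |lam| + 4 ≤ (n : ℝ) ^ (1 / 3 : ℝ) :=
    ((tendsto_rpow_atTop (by norm_num)).comp tendsto_natCast_atTop_atTop).eventually_ge_atTop _
  filter_upwards [hx_ev, ho.bound (show 0 < 1 / B ^ 2 by positivity), eventually_ge_atTop 2]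
    with n hx hAn hn2
  have hn2' : (2 : ℝ) ≤ n := by exact_mod_cast hn2
  have hn0 : (0 : ℝ) < n := by linarith
  set x : ℝ := (n : ℝ) ^ (1 / 3 : ℝ) with hx_def
  have hx4 : 4 ≤ x := by linarith [abs_nonneg lam]
  have hx0 : 0 < x := by linarith
  have hx2 : (n : ℝ) ^ ((2 : ℝ) / 3) = x ^ 2 := by
    rw [hx_def, ← Real.rpow_natCast, ← Real.rpow_mul hn0.le]; norm_num
  have hx3 : x ^ 3 = n := by
    rw [hx_def, ← Real.rpow_natCast, ← Real.rpow_mul hn0.le]; norm_num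
  have hxinv : (n : ℝ) ^ (-(1 / 3 : ℝ)) = 1 / x := by
    rw [Real.rpow_neg hn0.le]
    exact (one_div x).symm
  have ha := hA n
  set a := A n with ha_def
  have ha1 : 1 ≤ a := by nlinarith
  have ha0 : 0 < a := by linarith
  rw [hx2, Real.norm_of_nonneg ha0.le, Real.norm_of_nonneg (by positivity), one_div_mul_eq_div,
    le_div_iff₀ (by positivity)] at hAn
  have hT_def : Tof n a = ⌈x ^ 2 / a⌉₊ := by rw [Tof, hx2]
  set T := Tof n a with hT
  have hxa : B ^ 2 ≤ x ^ 2 / a := by rw [le_div_iff₀ ha0]; linarith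
  have hTlow : B ^ 2 ≤ T := hxa.trans (by rw [hT_def]; exact Nat.le_ceil _)
  have hThigh : (T : ℝ) * a ≤ 2 * x ^ 2 := by
    have h1 : (T : ℝ) < x ^ 2 / a + 1 := by rw [hT_def]; exact Nat.ceil_lt_add_one (by positivity)
    have h2 : (T : ℝ) ≤ 2 * (x ^ 2 / a) := by nlinarith
    calc (T : ℝ) * a ≤ 2 * (x ^ 2 / a) * a := by gcongr
      _ = _ := by field_simp
  have hT0 : (0 : ℝ) < T := by nlinarith
  have hTpos : 0 < T := by exact_mod_cast hT0
  have hTn : 2 * T ≤ n := by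
    have : (2 : ℝ) * T ≤ n := by
      have h1 : (T : ℝ) ≤ T * a := by nlinarith
      rw [← hx3]
      nlinarith [sq_nonneg x]
    exact_mod_cast this
  have hL_def : Lof n a = n / (2 * T) := rfl
  set L := Lof n a with hL
  have hL1 : 1 ≤ L := by rw [hL_def]; exact Nat.div_pos hTn (by omega)
  have hL1' : (1 : ℝ) ≤ L := by exact_mod_cast hL1
  have hLT2 : 2 * ((L : ℝ) * T) ≤ n := by
    have : L * (2 * T) ≤ n := by rw [hL_def]; exact Nat.div_mul_le_self _ _
    have : (L : ℝ) * (2 * T) ≤ n := by exact_mod_cast this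
    linarith
  have hLT4 : (n : ℝ) ≤ 4 * (L * T) := by
    have h1 : n < (L + 1) * (2 * T) := by
      rw [hL_def]
      exact Nat.lt_mul_of_div_lt (Nat.lt_succ_self _) (by omega)
    have h2 : (n : ℝ) < (L + 1) * (2 * T) := by exact_mod_cast h1
    nlinarith
  set s := Real.sqrt T with hs
  have hsT : s ^ 2 = T := Real.sq_sqrt hT0.le
  have hsB : B ≤ s := Real.le_sqrt_of_sq_le hTlow
  set y := B * (L : ℝ) * s with hy
  have hy0 : 0 ≤ y := by positivity
  have hy2 : 2 ≤ y := by
    calc (2 : ℝ) ≤ 200 * 1 * 1 := by norm_num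
      _ ≤ y := by rw [hy]; gcongr; linarith
  have hyn : y ≤ n := by
    have : y ≤ L * T := by
      calc y = L * (B * s) := by rw [hy]; ring
        _ ≤ L * (s * s) := by gcongr
        _ = _ := by rw [← hsT]; ring
    nlinarith
  have hm1 : (⌊y⌋₊ : ℝ) ≤ y := Nat.floor_le hy0
  have hm2 : y ≤ 2 * (⌊y⌋₊ : ℝ) := by
    have h1 := Nat.lt_floor_add_one y
    linarith
  have hlam := abs_le.1 (le_refl |lam|)
  have hp_lo : 0 ≤ 1 + lam * (1 / x) := by
    have : -1 ≤ lam / x := by rw [le_div_iff₀ hx0]; linarith [hlam.1]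
    rw [mul_one_div]; linarith
  have hp_hi : 1 + lam * (1 / x) ≤ 1 + (|lam| + 1) / x := by
    rw [mul_one_div]; gcongr; linarith [hlam.2]
  have hp_two : 1 + (|lam| + 1) / x ≤ 2 := by
    have : (|lam| + 1) / x ≤ 1 := by rw [div_le_one hx0]; linarith
    linarith
  have hp0 : 0 ≤ pER n lam := by rw [pER, hxinv]; positivity
  have hpn : pER n lam * n = 1 + lam * (1 / x) := by
    rw [pER, hxinv, div_mul_cancel₀ _ hn0.ne']
  have hp1 : pER n lam ≤ 1 := by rw [pER, hxinv, div_le_one hn0]; linarith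
  have hset : {ω : Sym2 (Fin n) → Bool | y < (erHit ω (2 * L - 1) : ℝ)} =
      {ω | ⌊y⌋₊ < erHit ω ((2 * L - 2) + 1)} := by
    ext ω
    have : 2 * L - 1 = 2 * L - 2 + 1 := by omega
    simp only [Set.mem_ofPred_eq, this, Nat.floor_lt hy0]
  rw [hset]
  refine (measure_lt_erHit_le (θ := 1 / s) hp0 hp1 (by positivity) (by omega)
    (Nat.floor_le_of_le hyn)).trans (ENNReal.ofReal_le_ofReal (Real.exp_le_exp.2 ?_))
  refine chernoff_exponent_le (L := L) (T := T) (x := x) (a := a) (B := B) (Λ := |lam| + 1) hn0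
    (by positivity) (hm1.trans hyn) (by positivity) (by linarith) hsT hx0 hx3 (by positivity) ha
    ?_ hB hThigh hLT4 hm1 hm2 (hpn.trans_le hp_hi) rfl ?_
  · rw [← Real.rpow_natCast, ← Real.rpow_mul ha0.le]
    norm_num
  · rw [Nat.cast_sub (by omega)]
    push_cast
    linarith

end
end

section
/- Let (U_i)_{i≥1} be iid Uniform([0,1]) random variables independent of all other randomness, fix m ≥ 1, and for i ≤ ⌊B L T^{1/2}⌋ define η''_i := 1_{R_i}(d−2) + 1_{R_i} 1_{F_i} 1_{{|V^{(d)}_{i−1}| ≤ a_n(i−1)+m}} − 1 and μ_i := 1_{R_i}(d−2) + 1_{R_i} 1_{{U_i ≤ d(a_n(i−1)+m)/(dn−2(i−1)−1)}} − 1, where a_n(i) = n − 1 − i + i²/(2n), F_i is the event that v(h_i) is fresh at the start of step i, and R_i is the event that the edge revealed at step i is retained. Then for every t ≤ ⌊B L T^{1/2}⌋, P(d + Σ_{i=1}^{t} η''_i > −4dL) ≤ P(d + Σ_{i=1}^{t} μ_i > −4dL). -/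
/-!
Statement 10 (Lemma `mainpropforupper`): with `(U_i)` iid `Uniform([0,1])` independent
of the exploration, `η''_i = 1_{R_i}(d-2) + 1_{R_i}1_{F_i}1_{|V^{(d)}_{i-1}| ≤ a_n(i-1)+m} - 1`
and `μ_i = 1_{R_i}(d-2) + 1_{R_i}1_{U_i ≤ d(a_n(i-1)+m)/(dn-2(i-1)-1)} - 1`, for every
`t ≤ ⌊B L T^{1/2}⌋` one has
`P(d + Σ_{i≤t} η''_i > -4dL) ≤ P(d + Σ_{i≤t} μ_i > -4dL)`.
-/
open MeasureTheory Filter Asymptotics ProbabilityTheory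

noncomputable section

/-- A half-edge (stub) of the configuration model: `(vertex, stub index)`. -/
abbrev Stub (n d : ℕ) := Fin n × Fin d

/-- The sample space of the percolated configuration model: a pairing of the stubs,
a retention coin for each step, a uniform starting vertex, and an auxiliary sequence
of iid uniform random variables on `[0,1]`. -/
abbrev CMSpace (n d : ℕ) :=
  (Stub n d → Stub n d) × (Fin (d * n) → Bool) × Fin n × (Fin (d * n) → ℝ)

/-- The uniform measure on a finite set of outcomes. -/
def uniformOn {α : Type*} [MeasurableSpace α] (s : Finset α) : Measure α :=
  (s.card : ENNReal)⁻¹ • ∑ a ∈ s, Measure.dirac a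

/-- Perfect matchings of the `dn` stubs (fixed-point free involutions). -/
def matchingsFinset (n d : ℕ) : Finset (Stub n d → Stub n d) :=
  Finset.univ.filter fun f => (∀ x, f (f x) = x) ∧ ∀ x, f x ≠ x

/-- The law of the percolated configuration model together with its auxiliary
randomness: a uniform pairing of the stubs, iid Bernoulli(`p`) retention coins
(one per step), a uniform starting vertex, and iid uniforms on `[0,1]`. -/
def cmMeasure (n d : ℕ) (p : ℝ) : Measure (CMSpace n d) :=
  (uniformOn (matchingsFinset n d)).prod
    ((Measure.pi fun _ : Fin (d * n) => bernoulliBool p).prod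
      ((uniformOn (Finset.univ : Finset (Fin n))).prod
        (Measure.pi fun _ : Fin (d * n) => volume.restrict (Set.Icc (0 : ℝ) 1))))

/-- The retention coin used at step `t ≥ 1`: the event `R_t` is `cmBit t ω = true`. -/
def cmBit {n d : ℕ} (t : ℕ) (ω : CMSpace n d) : Bool :=
  if h : t - 1 < d * n then ω.2.1 ⟨t - 1, h⟩ else false

/-- The auxiliary uniform random variable `U_k` (`k ≥ 1`). -/
def cmU {n d : ℕ} (k : ℕ) (ω : CMSpace n d) : ℝ :=
  if h : k - 1 < d * n then ω.2.2.2 ⟨k - 1, h⟩ else 0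

/-- Unseen stubs of an exploration state `(active, explored)`. -/
def cmUnseen {n d : ℕ} (st : Finset (Stub n d) × Finset (Stub n d)) : Finset (Stub n d) :=
  Finset.univ \ (st.1 ∪ st.2)

/-- The stub from which the next step proceeds: an active stub if there is one,
otherwise an unseen stub, otherwise none (the process has finished). -/
def cmPick {n d : ℕ} (st : Finset (Stub n d) × Finset (Stub n d)) : Option (Stub n d) :=
  if h : st.1.Nonempty then some h.choose
  else if h' : (cmUnseen st).Nonempty then some h'.choose else none

/-- One step of the exploration process of the percolated configuration model
(Algorithm 2), given the pairing `M` and the retention coin `b` of this step. -/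
def cmStep {n d : ℕ} (M : Stub n d → Stub n d) (b : Bool)
    (st : Finset (Stub n d) × Finset (Stub n d)) :
    Finset (Stub n d) × Finset (Stub n d) :=
  match cmPick st with
  | none => st
  | some e =>
    let A₁ := if st.1.Nonempty then st.1
      else st.1 ∪ ((cmUnseen st).filter fun s => s.1 = e.1)
    let h := M e
    let E' := insert e (insert h st.2)
    if h ∈ A₁ then ((A₁.erase e).erase h, E')
    else if b then
      ((A₁.erase e) ∪
        (((Finset.univ \ (A₁ ∪ st.2)).filter fun s => s.1 = h.1).erase h), E')
    else (A₁.erase e, E')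

/-- The state `(active stubs, explored stubs)` of the exploration of the percolated
configuration model at the end of step `t`; at time `0` the `d` stubs of the uniformly
chosen starting vertex are active and all other stubs are unseen. -/
def cmState (n d : ℕ) (ω : CMSpace n d) : ℕ → Finset (Stub n d) × Finset (Stub n d)
  | 0 => (Finset.univ.filter fun s : Stub n d => s.1 = ω.2.2.1, ∅)
  | t + 1 => cmStep ω.1 (cmBit (t + 1) ω) (cmState n d ω t)

/-- `Y t`, the number of active stubs at the end of step `t`. -/
def cmY (n d : ℕ) (ω : CMSpace n d) (t : ℕ) : ℕ := (cmState n d ω t).1.card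

/-- The hitting times `t_i`: `t_0 = 0`, `t_i = min {t > t_{i-1} : Y_t = 0}`. -/
def cmHit (n d : ℕ) (ω : CMSpace n d) : ℕ → ℕ
  | 0 => 0
  | i + 1 => sInf {t | cmHit n d ω i < t ∧ cmY n d ω t = 0}

/-- The filtration of the exploration process: `F t` is the σ-algebra generated by
the information revealed up to time `t` (history of states and retention coins). -/
def cmF (n d : ℕ) (t : ℕ) : MeasurableSpace (CMSpace n d) :=
  MeasurableSpace.comap
    (fun ω => ((fun s : Fin (t + 1) => cmState n d ω s), fun s : Fin t => cmBit (s + 1) ω)) ⊤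

/-- The near-critical percolation probability `p = (1 + λ n^{-1/3})/(d-1)`. -/
def pReg (d n : ℕ) (lam : ℝ) : ℝ := (1 + lam * (n : ℝ) ^ (-(1 / 3 : ℝ))) / (d - 1)

/-- `T = (d-1)⌈n^{2/3}/A⌉`. -/
def TofD (d n : ℕ) (a : ℝ) : ℕ := (d - 1) * Nat.ceil ((n : ℝ) ^ ((2 : ℝ) / 3) / a)

/-- `L = ⌊dn/(4T)⌋`. -/
def LofD (d n : ℕ) (a : ℝ) : ℕ := d * n / (4 * TofD d n a)

/-- The set of fresh vertices (all `d` stubs unseen) at the end of step `k`. -/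
def cmFresh (n d : ℕ) (ω : CMSpace n d) (k : ℕ) : Finset (Fin n) :=
  Finset.univ.filter fun v => ∀ j : Fin d, (v, j) ∈ cmUnseen (cmState n d ω k)

/-- The stub `e_t` from which step `t ≥ 1` proceeds. -/
def cmE (n d : ℕ) (ω : CMSpace n d) (t : ℕ) : Option (Stub n d) :=
  cmPick (cmState n d ω (t - 1))

/-- The event that the stub `h_t` paired at step `t` is active at time `t-1`. -/
def cmHActive (n d : ℕ) (ω : CMSpace n d) (t : ℕ) : Prop :=
  ∃ e, cmE n d ω t = some e ∧ ω.1 e ∈ (cmState n d ω (t - 1)).1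

/-- The event `F_t` that the vertex `v(h_t)` of the stub paired at step `t` is fresh
at the start of step `t`. -/
def cmHFresh (n d : ℕ) (ω : CMSpace n d) (t : ℕ) : Prop :=
  ∃ e, cmE n d ω t = some e ∧
    ∀ j : Fin d, ((ω.1 e).1, j) ∈ cmUnseen (cmState n d ω (t - 1))

/-- `d_i`, the number of unseen stubs of the vertex from which the exploration of the
`i`-th cluster starts. -/
def cmDStart (n d : ℕ) (ω : CMSpace n d) (i : ℕ) : ℕ :=
  match cmE n d ω (cmHit n d ω (i - 1) + 1) with
  | some e => ((cmUnseen (cmState n d ω (cmHit n d ω (i - 1)))).filter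
      fun s => s.1 = e.1).card
  | none => 0

/-- `η^i_k`, the increment of the number of active stubs at step `t_{i-1}+k` (at the
first step of the cluster, the initial activation of the `d_i` stubs of the starting
vertex is not counted). -/
def cmEtaI (n d : ℕ) (ω : CMSpace n d) (i k : ℕ) : ℤ :=
  (cmY n d ω (cmHit n d ω (i - 1) + k) : ℤ) - (cmY n d ω (cmHit n d ω (i - 1) + k - 1) : ℤ)
    - (if k = 1 then (cmDStart n d ω i : ℤ) else 0)

/-- `a_n(i) = n - 1 - i + i²/(2n)`. -/
def anFun (n i : ℕ) : ℝ := (n : ℝ) - 1 - i + (i : ℝ) ^ 2 / (2 * n)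

open scoped Classical

-- stmt 10 defs
/-- `η''_i = 1_{R_i}(d-2) + 1_{R_i} 1_{F_i} 1_{|V^{(d)}_{i-1}| ≤ a_n(i-1)+m} - 1`. -/
def etaDP (n d m : ℕ) (ω : CMSpace n d) (i : ℕ) : ℤ :=
  (if cmBit i ω then (d : ℤ) - 2 else 0) +
    (if cmBit i ω ∧ cmHFresh n d ω i ∧
        (((cmFresh n d ω (i - 1)).card : ℝ) ≤ anFun n (i - 1) + m) then 1 else 0) - 1

/-- `μ_i = 1_{R_i}(d-2) + 1_{R_i} 1_{U_i ≤ d(a_n(i-1)+m)/(dn-2(i-1)-1)} - 1`. -/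
def muDP (n d m : ℕ) (ω : CMSpace n d) (i : ℕ) : ℤ :=
  (if cmBit i ω then (d : ℤ) - 2 else 0) +
    (if cmBit i ω ∧
        cmU i ω ≤ (d : ℝ) * (anFun n (i - 1) + m) /
          ((d : ℝ) * n - 2 * ((i - 1 : ℕ) : ℝ) - 1) then 1 else 0) - 1

/-- Fixed-point free involutions, described pointwise. -/
def IsMatching {σ : Type*} (f : σ → σ) : Prop := (∀ x, f (f x) = x) ∧ ∀ x, f x ≠ x

lemma IsMatching.even_card {σ : Type*} [Fintype σ] {f : σ → σ} (hf : IsMatching f) :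
    Even (Fintype.card σ) := by
  have h : ∑ _x : σ, (1 : ZMod 2) = 0 :=
    Finset.sum_involution (fun x _ => f x) (fun _ _ => by decide) (fun x _ _ => hf.2 x)
      (fun _ _ => Finset.mem_univ _) fun x _ => hf.1 x
  rw [Finset.sum_const, nsmul_eq_mul, mul_one, Finset.card_univ] at h
  exact ZMod.natCast_eq_zero_iff_even.1 h

/-- The matching obtained from `f` by exchanging the roles of `a` and `b`. -/
def swapMatching {σ : Type*} [DecidableEq σ] (a b : σ) (f : σ → σ) : σ → σ :=
  fun x => Equiv.swap a b (f (Equiv.swap a b x))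

lemma IsMatching.swapMatching {σ : Type*} [DecidableEq σ] {f : σ → σ} (hf : IsMatching f) (a b : σ) :
    IsMatching (swapMatching a b f) := by
  refine ⟨fun x => ?_, fun x hx => ?_⟩
  · simp [_root_.swapMatching, hf.1]
  · apply hf.2 (Equiv.swap a b x)
    have := congrArg (Equiv.swap a b) hx
    simpa [_root_.swapMatching] using this

/-- Let `S` be a family of matchings, and suppose that `e M`, the explored set `E M` and the target
set `G M`, as well as membership in `S`, only depend on the restriction of `M` to `E M`. Then the
partner of `e M` is uniform on the unexplored points, so that it hits `G M` with
proportion at most `g / (|σ| - |E M| - 1)`. -/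
lemma card_partner_mem_le {σ : Type*} [Fintype σ] [DecidableEq σ] (S : Finset (σ → σ)) (e : (σ → σ) → σ)
    (E G : (σ → σ) → Finset σ) (c : ℕ) (g : ℝ)
    (hS : ∀ M ∈ S, IsMatching M)
    (he : ∀ M ∈ S, e M ∉ E M) (hE : ∀ M ∈ S, ∀ x ∈ E M, M x ∈ E M)
    (hc : ∀ M ∈ S, (E M).card = c) (hg : ∀ M ∈ S, ((G M).card : ℝ) ≤ g)
    (hinv : ∀ M ∈ S, ∀ M', IsMatching M' → (∀ x ∈ E M, M' x = M x) →
      M' ∈ S ∧ e M' = e M ∧ E M' = E M ∧ G M' = G M) :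
    ((S.filter fun M => M (e M) ∈ G M).card : ℝ) * ((Fintype.card σ : ℝ) - c - 1)
      ≤ g * S.card := by
  set R : (σ → σ) → Finset σ := fun M => Finset.univ \ insert (e M) (E M) with hR
  have hRcard : ∀ M ∈ S, ((R M).card : ℝ) = (Fintype.card σ : ℝ) - c - 1 := by
    intro M hM
    have h1 : (R M).card + (insert (e M) (E M)).card = Fintype.card σ := by
      rw [hR, ← Finset.card_univ]
      exact Finset.card_sdiff_add_card_eq_card (Finset.subset_univ _)
    rw [Finset.card_insert_of_notMem (he M hM), hc M hM] at h1
    have h2 : ((R M).card : ℝ) + (c + 1) = Fintype.card σ := by exact_mod_cast h1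
    linarith
  have hkey : ∀ M ∈ S, ∀ h ∈ R M,
      swapMatching (M (e M)) h M ∈ S ∧ e (swapMatching (M (e M)) h M) = e M ∧
      E (swapMatching (M (e M)) h M) = E M ∧ G (swapMatching (M (e M)) h M) = G M ∧
      swapMatching (M (e M)) h M (e M) = h ∧ M (e M) ∈ R M := by
    intro M hM h hh
    simp only [hR, Finset.mem_sdiff, Finset.mem_univ, true_and, Finset.mem_insert, not_or] at hh
    have hMe : M (e M) ∉ E M := fun hx => he M hM (by simpa [(hS M hM).1] using hE M hM _ hx)
    have hne := (hS M hM).2 (e M)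
    have hfix : ∀ x ∈ E M, Equiv.swap (M (e M)) h x = x := fun x hx =>
      Equiv.swap_apply_of_ne_of_ne (fun h' => hMe (h' ▸ hx)) (fun h' => hh.2 (h' ▸ hx))
    obtain ⟨h1, h2, h3, h4⟩ := hinv M hM _ ((hS M hM).swapMatching (M (e M)) h)
      (fun x hx => by simp only [swapMatching]; rw [hfix x hx, hfix _ (hE M hM x hx)])
    refine ⟨h1, h2, h3, h4, ?_, ?_⟩
    · simp only [swapMatching]
      rw [Equiv.swap_apply_of_ne_of_ne hne.symm (fun h' => hh.1 h'.symm), Equiv.swap_apply_left]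
    · simp [hR, hMe, hne]
  have hcard : ((S.filter fun M => M (e M) ∈ G M).sigma fun M => R M).card
      ≤ (S.sigma fun M => G M).card := by
    refine Finset.card_le_card_of_injOn
      (fun x => ⟨swapMatching (x.1 (e x.1)) x.2 x.1, x.1 (e x.1)⟩) ?_ ?_
    · rintro ⟨M, h⟩ hx
      simp only [Finset.coe_sigma, Set.mem_sigma_iff, Finset.mem_coe, Finset.mem_filter] at hx ⊢
      obtain ⟨h1, -, -, h4, -, -⟩ := hkey M hx.1.1 h hx.2
      exact ⟨h1, h4 ▸ hx.1.2⟩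
    · rintro ⟨M, h⟩ hx ⟨M', h'⟩ hx' heq
      simp only [Finset.coe_sigma, Set.mem_sigma_iff, Finset.mem_coe, Finset.mem_filter] at hx hx'
      obtain ⟨-, h2, -, -, h5, -⟩ := hkey M hx.1.1 h hx.2
      obtain ⟨-, h2', -, -, h5', -⟩ := hkey M' hx'.1.1 h' hx'.2
      simp only [Sigma.mk.injEq, heq_eq_eq] at heq
      obtain ⟨ha, hb⟩ := heq
      have hee : e M = e M' := by rw [← h2, ← h2', ha]
      have hhh : h = h' := by
        have := congrFun ha (e M)
        rwa [h5, hee, h5'] at this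
      subst hhh
      have hMM : M = M' := by
        rw [hb] at ha
        funext x
        have := congrFun ha (Equiv.swap (M' (e M')) h x)
        simpa [swapMatching] using this
      subst hMM
      rfl
  rw [Finset.card_sigma, Finset.card_sigma] at hcard
  have hcard' : (∑ M ∈ S.filter fun M => M (e M) ∈ G M, ((R M).card : ℝ))
      ≤ ∑ M ∈ S, ((G M).card : ℝ) := by exact_mod_cast hcard
  rw [Finset.sum_congr rfl fun M hM => hRcard M (Finset.mem_filter.1 hM).1] at hcard'
  have := hcard'.trans (Finset.sum_le_sum hg)
  rwa [Finset.sum_const, nsmul_eq_mul, Finset.sum_const, nsmul_eq_mul, mul_comm _ g] at this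

lemma measurable_sum_range_ite {γ : Type*} [MeasurableSpace γ] {Z : ℕ → γ → Prop}
    (hZ : ∀ i, MeasurableSet {x | Z i x}) (t : ℕ) :
    Measurable fun x => ∑ i ∈ Finset.range t, if Z i x then (1 : ℤ) else 0 :=
  Finset.measurable_sum _ fun i _ => Measurable.ite (hZ i) measurable_const measurable_const

lemma measureReal_sub_one_le_sum {γ : Type*} [MeasurableSpace γ] (ρ : Measure γ)
    [IsFiniteMeasure ρ] {Z : ℕ → γ → Prop} (hZ : ∀ i, MeasurableSet {x | Z i x}) (t : ℕ) (k : ℤ) :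
    ρ.real {x | k - 1 ≤ ∑ i ∈ Finset.range t, if Z i x then (1 : ℤ) else 0}
      = ρ.real {x | k ≤ ∑ i ∈ Finset.range t, if Z i x then (1 : ℤ) else 0}
        + ρ.real {x | (∑ i ∈ Finset.range t, if Z i x then (1 : ℤ) else 0) = k - 1} := by
  have hm : MeasurableSet
      {x | (∑ i ∈ Finset.range t, if Z i x then (1 : ℤ) else 0) = k - 1} :=
    measurable_sum_range_ite hZ t (measurableSet_singleton (k - 1))
  rw [← measureReal_union _ hm]
  · congr 1
    ext x
    simp only [Set.mem_ofPred_eq, Set.mem_union]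
    omega
  · rw [Set.disjoint_left]
    intro x hx hx'
    simp only [Set.mem_ofPred_eq] at hx hx'
    omega

lemma measureReal_le_sum_succ {γ : Type*} [MeasurableSpace γ] (ρ : Measure γ)
    [IsFiniteMeasure ρ] {Z : ℕ → γ → Prop} (hZ : ∀ i, MeasurableSet {x | Z i x}) (t : ℕ) (k : ℤ) :
    ρ.real {x | k ≤ ∑ i ∈ Finset.range (t + 1), if Z i x then (1 : ℤ) else 0}
      = ρ.real {x | k ≤ ∑ i ∈ Finset.range t, if Z i x then (1 : ℤ) else 0}
        + ρ.real {x | (∑ i ∈ Finset.range t, if Z i x then (1 : ℤ) else 0) = k - 1 ∧ Z t x} := by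
  have hm : MeasurableSet
      {x | (∑ i ∈ Finset.range t, if Z i x then (1 : ℤ) else 0) = k - 1 ∧ Z t x} :=
    (measurable_sum_range_ite hZ t (measurableSet_singleton (k - 1))).inter (hZ t)
  rw [← measureReal_union _ hm]
  · congr 1
    ext x
    simp only [Set.mem_ofPred_eq, Set.mem_union, Finset.sum_range_succ]
    by_cases h : Z t x <;> simp only [h, if_true, if_false, and_true, and_false, or_false, add_zero]
    omega
  · rw [Set.disjoint_left]
    intro x hx hx'
    simp only [Set.mem_ofPred_eq] at hx hx'
    omega

/-- Stochastic domination of a sum of adapted indicators by a sum of independent ones, when the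
conditional success probability `q i` of the latter dominates at each step. -/
lemma measureReal_le_sum_of_step {α β : Type*} [MeasurableSpace α] [MeasurableSpace β]
    (μ : Measure α) (ν : Measure β) [IsFiniteMeasure μ] [IsProbabilityMeasure ν]
    (P : ℕ → α → Prop) (Q : ℕ → β → Prop) (q : ℕ → ℝ)
    (hP : ∀ i, MeasurableSet {x | P i x}) (hQ : ∀ i, MeasurableSet {y | Q i y})
    (hq0 : ∀ i, 0 ≤ q i) (hq1 : ∀ i, q i ≤ 1)
    (hμ : ∀ t (k : ℤ), μ.real {x | (∑ i ∈ Finset.range t, if P i x then (1 : ℤ) else 0) = k ∧ P t x}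
      ≤ q t * μ.real {x | (∑ i ∈ Finset.range t, if P i x then (1 : ℤ) else 0) = k})
    (hν : ∀ t (k : ℤ), ν.real {y | (∑ i ∈ Finset.range t, if Q i y then (1 : ℤ) else 0) = k ∧ Q t y}
      = q t * ν.real {y | (∑ i ∈ Finset.range t, if Q i y then (1 : ℤ) else 0) = k})
    (t : ℕ) (k : ℤ) :
    μ.real {x | k ≤ ∑ i ∈ Finset.range t, if P i x then (1 : ℤ) else 0}
      ≤ μ.real Set.univ * ν.real {y | k ≤ ∑ i ∈ Finset.range t, if Q i y then (1 : ℤ) else 0} := by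
  induction t generalizing k with
  | zero =>
    simp only [Finset.range_zero, Finset.sum_empty]
    by_cases hk : k ≤ 0 <;> simp [hk]
  | succ t ih =>
    rw [measureReal_le_sum_succ μ hP, measureReal_le_sum_succ ν hQ, hν]
    have h1 := hμ t (k - 1)
    have h2 := measureReal_sub_one_le_sum μ hP t k
    have h3 := measureReal_sub_one_le_sum ν hQ t k
    have h4 := mul_le_mul_of_nonneg_left (ih k) (sub_nonneg.2 (hq1 t))
    have h5 := mul_le_mul_of_nonneg_left (ih (k - 1)) (hq0 t)
    rw [h2, h3] at h5
    linarith

instance isProbabilityMeasure_restrict_Icc :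
    IsProbabilityMeasure ((volume : Measure ℝ).restrict (Set.Icc (0 : ℝ) 1)) :=
  ⟨by simp⟩

lemma min_le_measureReal_pi_le {N : ℕ} (j : Fin N) {x : ℝ} (hx : 0 ≤ x) :
    min x 1 ≤ (Measure.pi fun _ : Fin N => (volume : Measure ℝ).restrict (Set.Icc (0 : ℝ) 1)).real
      {U | U j ≤ x} := by
  have h := (measurePreserving_eval
    (fun _ : Fin N => (volume : Measure ℝ).restrict (Set.Icc (0 : ℝ) 1)) j).measureReal_preimage
    (s := Set.Iic x) measurableSet_Iic.nullMeasurableSet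
  have h' : {U : Fin N → ℝ | U j ≤ x} = Function.eval j ⁻¹' Set.Iic x := rfl
  rw [h', h, measureReal_restrict_apply measurableSet_Iic]
  have hsub : Set.Icc 0 (min x 1) ⊆ Set.Iic x ∩ Set.Icc (0 : ℝ) 1 := fun y hy =>
    ⟨hy.2.trans (min_le_left _ _), hy.1, hy.2.trans (min_le_right _ _)⟩
  have hfin : (volume : Measure ℝ) (Set.Iic x ∩ Set.Icc (0 : ℝ) 1) ≠ ⊤ :=
    ((measure_mono Set.inter_subset_right).trans_lt (by simp)).ne
  refine le_trans ?_ (measureReal_mono hsub hfin)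
  rw [Real.volume_real_Icc_of_le (by positivity), sub_zero]

/-- Under a product measure, a coordinate is independent of any variable that does not depend
on it. -/
lemma measureReal_pi_inter_eval {N : ℕ} (ρ : Measure ℝ) [IsProbabilityMeasure ρ] (j : Fin N)
    (W : (Fin N → ℝ) → ℤ) (hW : Measurable W)
    (hWj : ∀ U U' : Fin N → ℝ, (∀ i, i ≠ j → U i = U' i) → W U = W U') (k : ℤ) (x : ℝ) :
    (Measure.pi fun _ : Fin N => ρ).real {U | W U = k ∧ U j ≤ x}
      = (Measure.pi fun _ : Fin N => ρ).real {U | U j ≤ x}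
        * (Measure.pi fun _ : Fin N => ρ).real {U | W U = k} := by
  have hind : iIndepFun (fun (i : Fin N) (U : Fin N → ℝ) => U i) (Measure.pi fun _ : Fin N => ρ) :=
    iIndepFun_pi (X := fun _ y => y) fun _ => aemeasurable_id
  have h := hind.indepFun_finset ({j}ᶜ) {j} disjoint_compl_left fun i => measurable_pi_apply i
  let ext : (({j}ᶜ : Finset (Fin N)) → ℝ) → Fin N → ℝ :=
    fun r i => if hi : i ∈ ({j}ᶜ : Finset (Fin N)) then r ⟨i, hi⟩ else 0
  have hext : Measurable ext := by
    refine measurable_pi_lambda _ fun i => ?_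
    by_cases hi : i ∈ ({j}ᶜ : Finset (Fin N))
    · simp only [ext, hi, dite_true]
      exact measurable_pi_apply _
    · simp only [ext, hi, dite_false]
      exact measurable_const
  have h2 := (h.comp (hW.comp hext)
    (measurable_pi_apply (⟨j, Finset.mem_singleton_self j⟩ : ({j} : Finset (Fin N)))))
  have h3 := h2.measure_inter_preimage_eq_mul {k} (Set.Iic x) (measurableSet_singleton k)
    measurableSet_Iic
  have hWe : ∀ U : Fin N → ℝ, W (ext fun i => U i) = W U := fun U =>
    hWj _ _ fun i hi => by simp [ext, hi]
  have e1 : ((W ∘ ext) ∘ fun (U : Fin N → ℝ) (i : ({j}ᶜ : Finset (Fin N))) => U i) ⁻¹' {k}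
      = {U | W U = k} := by
    ext U
    simp [hWe]
  have e2 : ((fun r : ({j} : Finset (Fin N)) → ℝ => r ⟨j, Finset.mem_singleton_self j⟩) ∘
      fun (U : Fin N → ℝ) (i : ({j} : Finset (Fin N))) => U i) ⁻¹' Set.Iic x
      = {U | U j ≤ x} := rfl
  rw [e1, e2] at h3
  rw [mul_comm, measureReal_def, measureReal_def, measureReal_def, ← ENNReal.toReal_mul, ← h3]
  rfl

section Exploration

variable {n d : ℕ}

lemma cmPick_eq_none_iff {st : Finset (Stub n d) × Finset (Stub n d)} :
    cmPick st = none ↔ st.1 = ∅ ∧ cmUnseen st = ∅ := by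
  unfold cmPick
  split_ifs with h h'
  · simp [h.ne_empty]
  · simp [h'.ne_empty]
  · simp [Finset.not_nonempty_iff_eq_empty.1 h, Finset.not_nonempty_iff_eq_empty.1 h']

lemma mem_of_cmPick_eq_some {st : Finset (Stub n d) × Finset (Stub n d)} {e : Stub n d}
    (h : cmPick st = some e) : e ∈ st.1 ∨ (st.1 = ∅ ∧ e ∈ cmUnseen st) := by
  unfold cmPick at h
  split_ifs at h with h1 h2
  · simp only [Option.some.injEq] at h
    exact Or.inl (h ▸ h1.choose_spec)
  · simp only [Option.some.injEq] at h
    exact Or.inr ⟨Finset.not_nonempty_iff_eq_empty.1 h1, h ▸ h2.choose_spec⟩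

lemma notMem_of_cmPick_eq_some {st : Finset (Stub n d) × Finset (Stub n d)} {e : Stub n d}
    (hd : Disjoint st.1 st.2) (h : cmPick st = some e) : e ∉ st.2 := by
  rcases mem_of_cmPick_eq_some h with h | ⟨-, h⟩
  · exact Finset.disjoint_left.1 hd h
  · simp only [cmUnseen, Finset.mem_sdiff, Finset.mem_union, not_or] at h
    exact h.2.2

lemma cmStep_of_none {st : Finset (Stub n d) × Finset (Stub n d)} (h : cmPick st = none)
    (M : Stub n d → Stub n d) (b : Bool) : cmStep M b st = st := by
  simp [cmStep, h]

lemma cmStep_snd_of_some {st : Finset (Stub n d) × Finset (Stub n d)} {e : Stub n d}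
    (h : cmPick st = some e) (M : Stub n d → Stub n d) (b : Bool) :
    (cmStep M b st).2 = insert e (insert (M e) st.2) := by
  simp only [cmStep, h]
  split_ifs <;> rfl

lemma cmStep_congr {st : Finset (Stub n d) × Finset (Stub n d)} {M M' : Stub n d → Stub n d}
    (h : ∀ e, cmPick st = some e → M' e = M e) (b : Bool) : cmStep M' b st = cmStep M b st := by
  cases hp : cmPick st with
  | none => simp [cmStep, hp]
  | some e => simp only [cmStep, hp, h e hp]

lemma disjoint_cmStep {st : Finset (Stub n d) × Finset (Stub n d)} {M : Stub n d → Stub n d}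
    (hM : IsMatching M) (hd : Disjoint st.1 st.2) (hE : ∀ x ∈ st.2, M x ∈ st.2) (b : Bool) :
    Disjoint (cmStep M b st).1 (cmStep M b st).2 := by
  cases hp : cmPick st with
  | none => rwa [cmStep_of_none hp]
  | some e =>
    have he := notMem_of_cmPick_eq_some hd hp
    have hMe : M e ∉ st.2 := fun hx => he (by simpa [hM.1] using hE _ hx)
    have hA : Disjoint (if st.1.Nonempty then st.1
        else st.1 ∪ ((cmUnseen st).filter fun s => s.1 = e.1)) st.2 := by
      split_ifs with h
      · exact hd
      · rw [Finset.disjoint_union_left]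
        refine ⟨hd, Finset.disjoint_left.2 fun x hx => ?_⟩
        simp only [cmUnseen, Finset.mem_filter, Finset.mem_sdiff, Finset.mem_union, not_or] at hx
        exact hx.1.2.2
    have heA : e ∈ (if st.1.Nonempty then st.1
        else st.1 ∪ ((cmUnseen st).filter fun s => s.1 = e.1)) := by
      rcases mem_of_cmPick_eq_some hp with h | ⟨h, h'⟩
      · split_ifs
        · exact h
        · exact Finset.mem_union_left _ h
      · rw [if_neg (by simp [h])]
        exact Finset.mem_union_right _ (by simp [h'])
    simp only [cmStep, hp]
    revert hA heA
    generalize (if st.1.Nonempty then st.1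
        else st.1 ∪ ((cmUnseen st).filter fun s => s.1 = e.1)) = A
    intro hA heA
    rw [Finset.disjoint_left] at hA
    split_ifs with h1 h2 <;> rw [Finset.disjoint_left] <;> intro x hx <;>
      simp only [Finset.mem_erase, Finset.mem_union, Finset.mem_filter, Finset.mem_sdiff,
        Finset.mem_univ, true_and, not_or, Finset.mem_insert] at hx ⊢
    · exact ⟨hx.2.1, hx.1, hA hx.2.2⟩
    · rcases hx with hx | hx
      · exact ⟨hx.1, fun h => h1 (h ▸ hx.2), hA hx.2⟩
      · exact ⟨fun h => hx.2.1.1 (h ▸ heA), hx.1, hx.2.1.2⟩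
    · exact ⟨hx.1, fun h => h1 (h ▸ hx.2), hA hx.2⟩

/-- Active and explored stubs are disjoint, the explored stubs are closed under the pairing,
and two stubs become explored at each step until the process is finished. -/
lemma cmState_invariant {ω : CMSpace n d} (hM : IsMatching ω.1) (t : ℕ) :
    Disjoint (cmState n d ω t).1 (cmState n d ω t).2 ∧
    (∀ x ∈ (cmState n d ω t).2, ω.1 x ∈ (cmState n d ω t).2) ∧
    (cmState n d ω t).2.card = min (2 * t) (n * d) := by
  induction t with
  | zero => simp [cmState]
  | succ t ih =>
    obtain ⟨h1, h2, h3⟩ := ih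
    simp only [cmState]
    generalize cmState n d ω t = st at h1 h2 h3
    refine ⟨disjoint_cmStep hM h1 h2 _, ?_⟩
    cases hp : cmPick st with
    | none =>
      rw [cmStep_of_none hp]
      refine ⟨h2, ?_⟩
      obtain ⟨h4, h5⟩ := cmPick_eq_none_iff.1 hp
      have h6 : st.2 = Finset.univ := by
        rw [cmUnseen, h4, Finset.empty_union, Finset.sdiff_eq_empty_iff_subset] at h5
        exact Finset.univ_subset_iff.1 h5
      rw [h6] at h3 ⊢
      simp only [Finset.card_univ, Fintype.card_prod, Fintype.card_fin] at h3 ⊢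
      omega
    | some e =>
      have he := notMem_of_cmPick_eq_some h1 hp
      have hMe : ω.1 e ∉ st.2 := fun hx => he (by simpa [hM.1] using h2 _ hx)
      rw [cmStep_snd_of_some hp]
      refine ⟨fun x hx => ?_, ?_⟩
      · simp only [Finset.mem_insert] at hx ⊢
        rcases hx with rfl | rfl | hx
        · simp
        · simp [hM.1]
        · simp [h2 x hx]
      · have hc : (insert e (insert (ω.1 e) st.2)).card = st.2.card + 2 := by
          rw [Finset.card_insert_of_notMem, Finset.card_insert_of_notMem hMe]
          simp [he, (hM.2 e).symm]
        have hle := Finset.card_le_univ (insert e (insert (ω.1 e) st.2))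
        simp only [Fintype.card_prod, Fintype.card_fin] at hle
        omega

lemma cmState_snd_mono (ω : CMSpace n d) {s t : ℕ} (hst : s ≤ t) :
    (cmState n d ω s).2 ⊆ (cmState n d ω t).2 := by
  induction t, hst using Nat.le_induction with
  | base => exact subset_rfl
  | succ t _ ih =>
    refine ih.trans ?_
    simp only [cmState]
    cases hp : cmPick (cmState n d ω t) with
    | none => rw [cmStep_of_none hp]
    | some e =>
      rw [cmStep_snd_of_some hp]
      exact (Finset.subset_insert _ _).trans (Finset.subset_insert _ _)

lemma mem_cmState_snd_of_cmE {ω : CMSpace n d} {s t : ℕ} (hst : s < t) {e : Stub n d}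
    (he : cmPick (cmState n d ω s) = some e) : e ∈ (cmState n d ω t).2 := by
  apply cmState_snd_mono ω (Nat.succ_le_of_lt hst)
  simp only [cmState]
  rw [cmStep_snd_of_some he]
  exact Finset.mem_insert_self _ _

/-- The exploration up to time `t` only depends on the coins, the starting vertex and the
partners of the stubs explored by time `t`. -/
lemma cmState_congr {M M' : Stub n d → Stub n d} {b : Fin (d * n) → Bool} {v : Fin n}
    {U U' : Fin (d * n) → ℝ} {t : ℕ}
    (h : ∀ x ∈ (cmState n d (M, b, v, U) t).2, M' x = M x) {s : ℕ} (hs : s ≤ t) :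
    cmState n d (M', b, v, U') s = cmState n d (M, b, v, U) s := by
  induction s with
  | zero => rfl
  | succ s ih =>
    have h1 := ih (by omega)
    have h2 : cmState n d (M', b, v, U') (s + 1)
      = cmStep M' (cmBit (s + 1) (M, b, v, U)) (cmState n d (M', b, v, U') s) := rfl
    rw [h2, h1]
    exact cmStep_congr (fun e he => h e (mem_cmState_snd_of_cmE (by omega) he)) _

lemma cmHFresh_congr {M M' : Stub n d → Stub n d} {b : Fin (d * n) → Bool} {v : Fin n}
    {U U' : Fin (d * n) → ℝ} {t : ℕ}
    (h : ∀ x ∈ (cmState n d (M, b, v, U) t).2, M' x = M x) {s : ℕ} (hs : s < t) :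
    cmHFresh n d (M', b, v, U') (s + 1) ↔ cmHFresh n d (M, b, v, U) (s + 1) := by
  simp only [cmHFresh, cmE, Nat.add_sub_cancel, cmState_congr (U' := U') h hs.le]
  refine exists_congr fun e => and_congr_right fun he => ?_
  rw [h e (mem_cmState_snd_of_cmE hs he)]

lemma cmFresh_congr {M M' : Stub n d → Stub n d} {b : Fin (d * n) → Bool} {v : Fin n}
    {U U' : Fin (d * n) → ℝ} {t : ℕ}
    (h : ∀ x ∈ (cmState n d (M, b, v, U) t).2, M' x = M x) {s : ℕ} (hs : s ≤ t) :
    cmFresh n d (M', b, v, U') s = cmFresh n d (M, b, v, U) s := by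
  simp only [cmFresh, cmState_congr (U' := U') h hs]

/-- The success event of the second indicator in `etaDP` at step `i + 1`. -/
def etaHit (n d m : ℕ) (ω : CMSpace n d) (i : ℕ) : Prop :=
  cmBit (i + 1) ω ∧ cmHFresh n d ω (i + 1) ∧ ((cmFresh n d ω i).card : ℝ) ≤ anFun n i + m

/-- The success event of the second indicator in `muDP` at step `i + 1`. -/
def muHit (n d m : ℕ) (ω : CMSpace n d) (i : ℕ) : Prop :=
  cmBit (i + 1) ω ∧ cmU (i + 1) ω ≤ (d : ℝ) * (anFun n i + m) / ((d : ℝ) * n - 2 * (i : ℝ) - 1)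

lemma etaHit_congr {m : ℕ} {M M' : Stub n d → Stub n d} {b : Fin (d * n) → Bool} {v : Fin n}
    {U U' : Fin (d * n) → ℝ} {t : ℕ}
    (h : ∀ x ∈ (cmState n d (M, b, v, U) t).2, M' x = M x) {s : ℕ} (hs : s < t) :
    etaHit n d m (M', b, v, U') s ↔ etaHit n d m (M, b, v, U) s := by
  simp only [etaHit, cmHFresh_congr (U' := U') h hs, cmFresh_congr (U' := U') h hs.le]
  rfl

/-- Conditionally on the exploration up to time `t`, a fresh vertex is hit at step `t + 1` while
the number of fresh vertices is at most `a` with probability at most `d a / (d n - 2 t - 1)`. -/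
lemma card_hit_mul_le {H : (Stub n d → Stub n d) → Prop} {b : Fin (d * n) → Bool}
    {v : Fin n} {U : Fin (d * n) → ℝ} {t : ℕ} {a : ℝ} (ha : 0 ≤ a) (ht : 2 * t < d * n)
    (hH : ∀ M M', IsMatching M → IsMatching M' →
      (∀ x ∈ (cmState n d (M, b, v, U) t).2, M' x = M x) → H M → H M') :
    (((matchingsFinset n d).filter fun M => H M ∧ cmHFresh n d (M, b, v, U) (t + 1) ∧
        ((cmFresh n d (M, b, v, U) t).card : ℝ) ≤ a).card : ℝ) * ((d : ℝ) * n - 2 * t - 1)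
      ≤ d * a * ((matchingsFinset n d).filter H).card := by
  have hd : 0 < d := Nat.pos_of_ne_zero (by rintro rfl; simp at ht)
  have hmem : ∀ M, M ∈ (matchingsFinset n d).filter H ↔ IsMatching M ∧ H M := fun M => by
    simp [matchingsFinset, IsMatching]
  have hcard : n * d = d * n := mul_comm _ _
  have hpick : ∀ M, IsMatching M → ∃ e, cmPick (cmState n d (M, b, v, U) t) = some e := by
    intro M hM
    rw [← Option.ne_none_iff_exists']
    intro h
    obtain ⟨h4, h5⟩ := cmPick_eq_none_iff.1 h
    obtain ⟨-, -, h3⟩ := cmState_invariant (ω := (M, b, v, U)) hM t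
    rw [cmUnseen, h4, Finset.empty_union, Finset.sdiff_eq_empty_iff_subset,
      Finset.univ_subset_iff] at h5
    rw [h5, Finset.card_univ, Fintype.card_prod, Fintype.card_fin, Fintype.card_fin] at h3
    omega
  let e : (Stub n d → Stub n d) → Stub n d :=
    fun M => (cmPick (cmState n d (M, b, v, U) t)).getD (v, ⟨0, hd⟩)
  have he : ∀ M, IsMatching M → cmPick (cmState n d (M, b, v, U) t) = some (e M) := by
    intro M hM
    obtain ⟨x, hx⟩ := hpick M hM
    simp [e, hx]
  let G : (Stub n d → Stub n d) → Finset (Stub n d) := fun M =>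
    if ((cmFresh n d (M, b, v, U) t).card : ℝ) ≤ a then
      cmFresh n d (M, b, v, U) t ×ˢ Finset.univ else ∅
  have key := card_partner_mem_le ((matchingsFinset n d).filter H) e
    (fun M => (cmState n d (M, b, v, U) t).2) G (2 * t) (d * a)
    (fun M hM => ((hmem M).1 hM).1)
    (fun M hM => notMem_of_cmPick_eq_some
      (cmState_invariant (ω := (M, b, v, U)) ((hmem M).1 hM).1 t).1 (he M ((hmem M).1 hM).1))
    (fun M hM => (cmState_invariant (ω := (M, b, v, U)) ((hmem M).1 hM).1 t).2.1)
    (fun M hM => by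
      rw [(cmState_invariant (ω := (M, b, v, U)) ((hmem M).1 hM).1 t).2.2]
      omega)
    (fun M hM => by
      simp only [G]
      split_ifs with h
      · rw [Finset.card_product, Finset.card_univ, Fintype.card_fin, Nat.cast_mul, mul_comm]
        gcongr
      · simp only [Finset.card_empty, Nat.cast_zero]
        positivity)
    (fun M hM M' hM' hMM' => by
      have hs := cmState_congr (U' := U) hMM' le_rfl
      have hf := cmFresh_congr (U' := U) hMM' le_rfl
      refine ⟨(hmem M').2 ⟨hM', hH M M' ((hmem M).1 hM).1 hM' hMM' ((hmem M).1 hM).2⟩, ?_, ?_, ?_⟩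
      · simp only [e, hs]
      · simp only [hs]
      · simp only [G, hf])
  have hset : ((matchingsFinset n d).filter H).filter (fun M => M (e M) ∈ G M)
      = (matchingsFinset n d).filter fun M => H M ∧ cmHFresh n d (M, b, v, U) (t + 1) ∧
        ((cmFresh n d (M, b, v, U) t).card : ℝ) ≤ a := by
    rw [Finset.filter_filter]
    refine Finset.filter_congr fun M hM => and_congr_right fun hHM => ?_
    have hM' : IsMatching M := ((hmem M).1 (Finset.mem_filter.2 ⟨hM, hHM⟩)).1
    have hfresh : cmHFresh n d (M, b, v, U) (t + 1)
        ↔ (M (e M)).1 ∈ cmFresh n d (M, b, v, U) t := by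
      simp [cmHFresh, cmE, he M hM', cmFresh]
    rw [hfresh]
    simp only [G]
    split_ifs with h <;> simp [h]
  rw [hset] at key
  have hN : ((Fintype.card (Stub n d) : ℕ) : ℝ) - ((2 * t : ℕ) : ℝ) - 1 = (d : ℝ) * n - 2 * t - 1 := by
    simp [mul_comm]
  rwa [hN] at key

lemma not_cmHFresh_of_le {ω : CMSpace n d} (hM : IsMatching ω.1) {t : ℕ} (ht : d * n ≤ 2 * t) :
    ¬ cmHFresh n d ω (t + 1) := by
  obtain ⟨h1, -, h3⟩ := cmState_invariant hM t
  have hcard : n * d = d * n := mul_comm _ _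
  have h6 : (cmState n d ω t).2 = Finset.univ := by
    rw [← Finset.card_eq_iff_eq_univ, h3, Fintype.card_prod, Fintype.card_fin, Fintype.card_fin]
    omega
  rintro ⟨e, he, -⟩
  simp only [cmE, Nat.add_sub_cancel] at he
  exact notMem_of_cmPick_eq_some h1 he (h6 ▸ Finset.mem_univ e)

end Exploration

lemma uniformOn_apply_eq {α : Type*} [MeasurableSpace α] [DiscreteMeasurableSpace α]
    (s : Finset α) (t : Set α) :
    _root_.uniformOn s t = (s.card : ENNReal)⁻¹ * (s.filter fun a => a ∈ t).card := by
  have h : ∀ a ∈ s, (Measure.dirac a : Measure α) t = if a ∈ t then 1 else 0 := fun a _ => by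
    rw [Measure.dirac_apply' a (MeasurableSet.of_discrete), Set.indicator_apply]
    rfl
  rw [_root_.uniformOn, Measure.smul_apply, Measure.finsetSum_apply, Finset.sum_congr rfl h,
    smul_eq_mul, Finset.sum_boole]

instance isFiniteMeasure_uniformOn {α : Type*} [MeasurableSpace α] [DiscreteMeasurableSpace α]
    (s : Finset α) : IsFiniteMeasure (_root_.uniformOn s) :=
  ⟨by
    rw [uniformOn_apply_eq]
    simpa using (ENNReal.inv_mul_le_one _).trans_lt ENNReal.one_lt_top⟩

instance isFiniteMeasure_bernoulliBool (p : ℝ) : IsFiniteMeasure (bernoulliBool p) := by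
  unfold bernoulliBool
  infer_instance

lemma uniformOn_real_eq {α : Type*} [MeasurableSpace α] [DiscreteMeasurableSpace α]
    (s : Finset α) (t : Set α) :
    (_root_.uniformOn s).real t = (s.card : ℝ)⁻¹ * (s.filter fun a => a ∈ t).card := by
  rw [measureReal_def, uniformOn_apply_eq]
  simp

section Comparison

variable {n d : ℕ}

lemma sum_etaDP_eq (m : ℕ) (ω : CMSpace n d) (t : ℕ) :
    ∑ i ∈ Finset.Icc 1 t, etaDP n d m ω i
      = ∑ i ∈ Finset.range t, ((if cmBit (i + 1) ω then (d : ℤ) - 2 else 0) - 1)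
        + ∑ i ∈ Finset.range t, if etaHit n d m ω i then 1 else 0 := by
  induction t with
  | zero => simp
  | succ t ih =>
    rw [Finset.sum_Icc_succ_top (by omega), ih, Finset.sum_range_succ, Finset.sum_range_succ]
    have h : etaDP n d m ω (t + 1) = ((if cmBit (t + 1) ω then (d : ℤ) - 2 else 0) - 1)
        + if etaHit n d m ω t then 1 else 0 := by
      simp only [etaDP, etaHit, Nat.add_sub_cancel]
      ring_nf
    rw [h]
    ring

lemma sum_muDP_eq (m : ℕ) (ω : CMSpace n d) (t : ℕ) :
    ∑ i ∈ Finset.Icc 1 t, muDP n d m ω i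
      = ∑ i ∈ Finset.range t, ((if cmBit (i + 1) ω then (d : ℤ) - 2 else 0) - 1)
        + ∑ i ∈ Finset.range t, if muHit n d m ω i then 1 else 0 := by
  induction t with
  | zero => simp
  | succ t ih =>
    rw [Finset.sum_Icc_succ_top (by omega), ih, Finset.sum_range_succ, Finset.sum_range_succ]
    have h : muDP n d m ω (t + 1) = ((if cmBit (t + 1) ω then (d : ℤ) - 2 else 0) - 1)
        + if muHit n d m ω t then 1 else 0 := by
      simp only [muDP, muHit, Nat.add_sub_cancel]
      ring_nf
    rw [h]
    ring

lemma measurable_cmBit (i : ℕ) : Measurable fun ω : CMSpace n d => cmBit i ω := by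
  unfold cmBit
  split_ifs with h
  · exact (measurable_pi_apply _).comp (measurable_fst.comp measurable_snd)
  · exact measurable_const

lemma measurable_cmU (i : ℕ) : Measurable fun ω : CMSpace n d => cmU i ω := by
  unfold cmU
  split_ifs with h
  · exact (measurable_pi_apply _).comp (measurable_snd.comp (measurable_snd.comp measurable_snd))
  · exact measurable_const

lemma measurableSet_muHit (m i : ℕ) : MeasurableSet {ω : CMSpace n d | muHit n d m ω i} :=
  (measurable_cmBit (i + 1) (measurableSet_singleton true)).inter
    (measurable_cmU (i + 1) measurableSet_Iic)

lemma etaHit_congr_uniform (m : ℕ) (M : Stub n d → Stub n d) (b : Fin (d * n) → Bool) (v : Fin n)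
    (U U' : Fin (d * n) → ℝ) (i : ℕ) :
    etaHit n d m (M, b, v, U') i ↔ etaHit n d m (M, b, v, U) i :=
  etaHit_congr (t := i + 1) (fun _ _ => rfl) (Nat.lt_succ_self i)

lemma measurableSet_etaHit (m i : ℕ) : MeasurableSet {ω : CMSpace n d | etaHit n d m ω i} := by
  have h : {ω : CMSpace n d | etaHit n d m ω i}
      = (fun ω : CMSpace n d => (ω.1, ω.2.1, ω.2.2.1)) ⁻¹'
        {y | etaHit n d m (y.1, y.2.1, y.2.2, 0) i} := by
    ext ⟨M, b, v, U⟩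
    exact etaHit_congr_uniform m M b v 0 U i
  rw [h]
  exact Measurable.prodMk measurable_fst (Measurable.prodMk (measurable_fst.comp measurable_snd)
    (measurable_fst.comp (measurable_snd.comp measurable_snd))) MeasurableSet.of_discrete

/-- The law of the auxiliary uniform variables. -/
abbrev uniformLaw (N : ℕ) : Measure (Fin N → ℝ) :=
  Measure.pi fun _ : Fin N => (volume : Measure ℝ).restrict (Set.Icc (0 : ℝ) 1)

/-- For fixed coins and starting vertex, `etaHit` is dominated by `muHit` conditionally on the
exploration up to time `t`. -/
lemma measureReal_etaHit_le (m : ℕ) (b : Fin (d * n) → Bool) (v : Fin n) (t : ℕ)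
    (H : (Stub n d → Stub n d) → Prop)
    (hH : ∀ M M', IsMatching M → IsMatching M' →
      (∀ x ∈ (cmState n d (M, b, v, 0) t).2, M' x = M x) → H M → H M') :
    (_root_.uniformOn (matchingsFinset n d)).real {M | H M ∧ etaHit n d m (M, b, v, 0) t}
      ≤ (uniformLaw (d * n)).real {U | muHit n d m (id, b, v, U) t}
        * (_root_.uniformOn (matchingsFinset n d)).real {M | H M} := by
  rw [uniformOn_real_eq, uniformOn_real_eq, mul_left_comm]
  refine mul_le_mul_of_nonneg_left ?_ (by positivity)
  simp only [Set.mem_ofPred_eq]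
  by_cases hpos : ∃ M ∈ matchingsFinset n d, H M ∧ etaHit n d m (M, b, v, 0) t
  swap
  · have h0 : ((matchingsFinset n d).filter
        fun M => H M ∧ etaHit n d m (M, b, v, 0) t) = ∅ := by
      rw [Finset.filter_eq_empty_iff]
      exact fun M hM h => hpos ⟨M, hM, h⟩
    rw [h0, Finset.card_empty, Nat.cast_zero]
    positivity
  obtain ⟨M₀, hM₀, -, hb, hfresh, hle⟩ := hpos
  have hM₀' : IsMatching M₀ := by simpa [matchingsFinset, IsMatching] using hM₀
  have ha : 0 ≤ anFun n t + m := (Nat.cast_nonneg _).trans hle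
  have ht : 2 * t < d * n := by
    by_contra! h
    exact not_cmHFresh_of_le (ω := (M₀, b, v, 0)) hM₀' h hfresh
  have htn : t < d * n := by omega
  have hN : 0 < (d : ℝ) * n - 2 * t - 1 := by
    have heven := hM₀'.even_card
    rw [Fintype.card_prod, Fintype.card_fin, Fintype.card_fin, mul_comm] at heven
    have : ((2 * t + 2 : ℕ) : ℝ) ≤ ((d * n : ℕ) : ℝ) := by
      obtain ⟨r, hr⟩ := heven
      exact_mod_cast (by omega : 2 * t + 2 ≤ d * n)
    push_cast at this
    linarith
  have hcount := card_hit_mul_le (U := 0) ha ht hH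
  have hsub : (((matchingsFinset n d).filter fun M => H M ∧ etaHit n d m (M, b, v, 0) t).card : ℝ)
      ≤ ((matchingsFinset n d).filter fun M => H M ∧ cmHFresh n d (M, b, v, 0) (t + 1) ∧
        ((cmFresh n d (M, b, v, 0) t).card : ℝ) ≤ anFun n t + m).card := by
    refine Nat.cast_le.2 (Finset.card_le_card fun M hM => ?_)
    rw [Finset.mem_filter] at hM ⊢
    exact ⟨hM.1, hM.2.1, hM.2.2.2⟩
  have hsub' : (((matchingsFinset n d).filter fun M => H M ∧ etaHit n d m (M, b, v, 0) t).card : ℝ)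
      ≤ ((matchingsFinset n d).filter H).card :=
    Nat.cast_le.2 (Finset.card_le_card fun M hM => by
      rw [Finset.mem_filter] at hM ⊢
      exact ⟨hM.1, hM.2.1⟩)
  have hset : {U : Fin (d * n) → ℝ | muHit n d m (id, b, v, U) t}
      = {U | U ⟨t, htn⟩ ≤ (d : ℝ) * (anFun n t + m) / ((d : ℝ) * n - 2 * (t : ℝ) - 1)} := by
    ext U
    have hb' : cmBit (t + 1) ((id, b, v, U) : CMSpace n d) = true := hb
    simp [muHit, hb', cmU, htn]
  rw [hset]
  refine le_trans ?_ (mul_le_mul_of_nonneg_right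
    (min_le_measureReal_pi_le ⟨t, htn⟩ (by positivity)) (Nat.cast_nonneg _))
  rcases le_total ((d : ℝ) * (anFun n t + m) / ((d : ℝ) * n - 2 * (t : ℝ) - 1)) 1 with h | h
  · rw [min_eq_left h, div_mul_eq_mul_div, le_div_iff₀ hN]
    exact (mul_le_mul_of_nonneg_right hsub hN.le).trans hcount
  · rwa [min_eq_right h, one_mul]

lemma measureReal_sum_etaHit_le (m : ℕ) (b : Fin (d * n) → Bool) (v : Fin n) (t : ℕ) (k : ℤ) :
    (_root_.uniformOn (matchingsFinset n d)).real
        {M | k ≤ ∑ i ∈ Finset.range t, if etaHit n d m (M, b, v, 0) i then (1 : ℤ) else 0}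
      ≤ (_root_.uniformOn (matchingsFinset n d)).real Set.univ * (uniformLaw (d * n)).real
        {U | k ≤ ∑ i ∈ Finset.range t, if muHit n d m (id, b, v, U) i then (1 : ℤ) else 0} := by
  have hmu : ∀ i, MeasurableSet {U : Fin (d * n) → ℝ | muHit n d m (id, b, v, U) i} := fun i =>
    (Measurable.prodMk measurable_const (Measurable.prodMk measurable_const
      (Measurable.prodMk measurable_const measurable_id))) (measurableSet_muHit m i)
  refine measureReal_le_sum_of_step _ _ (fun i M => etaHit n d m (M, b, v, 0) i)
    (fun i U => muHit n d m (id, b, v, U) i)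
    (fun i => (uniformLaw (d * n)).real {U | muHit n d m (id, b, v, U) i})
    (fun i => MeasurableSet.of_discrete) hmu (fun i => measureReal_nonneg)
    (fun i => measureReal_le_one) (fun t k => ?_) (fun t k => ?_) t k
  · refine measureReal_etaHit_le m b v t _ fun M M' _ _ h hk => ?_
    rw [← hk]
    refine Finset.sum_congr rfl fun i hi => ?_
    rw [if_congr (etaHit_congr h (Finset.mem_range.1 hi)) rfl rfl]
  · by_cases hb : t < d * n ∧ cmBit (t + 1) ((id, b, v, 0) : CMSpace n d) = true
    · obtain ⟨htn, hb⟩ := hb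
      have hiff : ∀ U : Fin (d * n) → ℝ, muHit n d m (id, b, v, U) t ↔ U ⟨t, htn⟩ ≤
          (d : ℝ) * (anFun n t + m) / ((d : ℝ) * n - 2 * (t : ℝ) - 1) := by
        intro U
        have hb' : cmBit (t + 1) ((id, b, v, U) : CMSpace n d) = true := hb
        simp [muHit, hb', cmU, htn]
      simp only [hiff]
      refine measureReal_pi_inter_eval _ ⟨t, htn⟩ _ (measurable_sum_range_ite hmu t)
        (fun U U' hUU' => Finset.sum_congr rfl fun i hi => ?_) k _
      have hi' := Finset.mem_range.1 hi
      refine if_congr (and_congr Iff.rfl ?_) rfl rfl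
      have hin : i < d * n := hi'.trans htn
      have : U ⟨i, hin⟩ = U' ⟨i, hin⟩ := hUU' _ (by simp [Fin.ext_iff, hi'.ne])
      simp [cmU, hin, this]
    · have hno : ∀ U : Fin (d * n) → ℝ, ¬ muHit n d m (id, b, v, U) t := by
        rintro U ⟨h, -⟩
        refine hb ⟨?_, h⟩
        by_contra htn
        simp [cmBit, htn] at h
      simp [hno]

end Comparison

theorem eta_doubleprime_le_mu (d : ℕ) (hd : 3 ≤ d) (lam : ℝ) (B : ℝ) (hB : 0 < B) (A : ℝ) (hA : 0 < A)
    (m : ℕ) (hm : 1 ≤ m) (n : ℕ) :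
    ∀ t ≤ Nat.floor (B * (LofD d n A : ℝ) * Real.sqrt (TofD d n A)),
      cmMeasure n d (pReg d n lam)
          {ω | -(4 * (d : ℤ) * LofD d n A) < (d : ℤ) + ∑ i ∈ Finset.Icc 1 t, etaDP n d m ω i}
        ≤ cmMeasure n d (pReg d n lam)
          {ω | -(4 * (d : ℤ) * LofD d n A) < (d : ℤ) + ∑ i ∈ Finset.Icc 1 t, muDP n d m ω i} := by
  intro t _
  have hcoin : Measurable fun ω : CMSpace n d =>
      ∑ i ∈ Finset.range t, ((if cmBit (i + 1) ω then (d : ℤ) - 2 else 0) - 1) :=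
    Finset.measurable_sum _ fun i _ => (Measurable.ite
      (measurable_cmBit (i + 1) (measurableSet_singleton true))
      measurable_const measurable_const).sub measurable_const
  set S₁ := {ω : CMSpace n d |
    -(4 * (d : ℤ) * LofD d n A) < (d : ℤ) + ∑ i ∈ Finset.Icc 1 t, etaDP n d m ω i} with hS₁
  set S₂ := {ω : CMSpace n d |
    -(4 * (d : ℤ) * LofD d n A) < (d : ℤ) + ∑ i ∈ Finset.Icc 1 t, muDP n d m ω i} with hS₂
  have hm₁ : MeasurableSet S₁ := by
    simp only [hS₁, sum_etaDP_eq]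
    exact measurableSet_lt measurable_const (measurable_const.add
      (hcoin.add (measurable_sum_range_ite (measurableSet_etaHit m) t)))
  have hm₂ : MeasurableSet S₂ := by
    simp only [hS₂, sum_muDP_eq]
    exact measurableSet_lt measurable_const (measurable_const.add
      (hcoin.add (measurable_sum_range_ite (measurableSet_muHit m) t)))
  have hdis : ∀ S : Set (CMSpace n d), MeasurableSet S → cmMeasure n d (pReg d n lam) S
      = ∫⁻ b, ∫⁻ v, ∫⁻ U, _root_.uniformOn (matchingsFinset n d) {M | (M, b, v, U) ∈ S}
        ∂(uniformLaw (d * n)) ∂(_root_.uniformOn (Finset.univ : Finset (Fin n)))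
        ∂(Measure.pi fun _ : Fin (d * n) => bernoulliBool (pReg d n lam)) := by
    intro S hS
    have hmeas : Measurable fun y : (Fin (d * n) → Bool) × Fin n × (Fin (d * n) → ℝ) =>
        _root_.uniformOn (matchingsFinset n d) ((fun M => (M, y)) ⁻¹' S) :=
      measurable_measure_prodMk_right hS
    rw [cmMeasure, Measure.prod_apply_symm hS, lintegral_prod _ hmeas.aemeasurable]
    refine lintegral_congr fun b => ?_
    exact lintegral_prod (fun z => _root_.uniformOn (matchingsFinset n d) {M | (M, b, z) ∈ S})
      (hmeas.comp measurable_prodMk_left).aemeasurable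
  rw [hdis S₁ hm₁, hdis S₂ hm₂]
  refine lintegral_mono fun b => lintegral_mono fun v => ?_
  set c : ℤ := -(4 * (d : ℤ) * LofD d n A) - d + 1 - ∑ i ∈ Finset.range t,
    ((if cmBit (i + 1) ((id, b, v, 0) : CMSpace n d) then (d : ℤ) - 2 else 0) - 1) with hc
  have h₁ : ∀ U, {M | (M, b, v, U) ∈ S₁}
      = {M | c ≤ ∑ i ∈ Finset.range t, if etaHit n d m (M, b, v, 0) i then (1 : ℤ) else 0} := by
    intro U
    ext M
    have hb : ∀ i, cmBit i (M, b, v, U) = cmBit i ((id, b, v, 0) : CMSpace n d) := fun _ => rfl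
    simp only [hS₁, Set.mem_ofPred_eq, sum_etaDP_eq, hb, etaHit_congr_uniform m M b v 0 U]
    omega
  have h₂ : ∀ U, {M | (M, b, v, U) ∈ S₂} = {_M : Stub n d → Stub n d |
      c ≤ ∑ i ∈ Finset.range t, if muHit n d m (id, b, v, U) i then (1 : ℤ) else 0} := by
    intro U
    ext M
    have hb : ∀ i, cmBit i (M, b, v, U) = cmBit i ((id, b, v, 0) : CMSpace n d) := fun _ => rfl
    have hmu : ∀ i, muHit n d m (M, b, v, U) i ↔ muHit n d m (id, b, v, U) i := fun _ => Iff.rfl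
    simp only [hS₂, Set.mem_ofPred_eq, sum_muDP_eq, hb, hmu]
    omega
  simp only [h₁, h₂, lintegral_const, measure_univ, mul_one]
  have hmu : MeasurableSet {U : Fin (d * n) → ℝ |
      c ≤ ∑ i ∈ Finset.range t, if muHit n d m (id, b, v, U) i then (1 : ℤ) else 0} :=
    measurableSet_le measurable_const (measurable_sum_range_ite (fun i =>
      (Measurable.prodMk measurable_const (Measurable.prodMk measurable_const
        (Measurable.prodMk measurable_const measurable_id))) (measurableSet_muHit m i)) t)
  have hint : ∫⁻ U, _root_.uniformOn (matchingsFinset n d) {_M : Stub n d → Stub n d |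
      c ≤ ∑ i ∈ Finset.range t, if muHit n d m (id, b, v, U) i then (1 : ℤ) else 0}
      ∂(uniformLaw (d * n)) = _root_.uniformOn (matchingsFinset n d) Set.univ *
        uniformLaw (d * n) {U : Fin (d * n) → ℝ |
          c ≤ ∑ i ∈ Finset.range t, if muHit n d m (id, b, v, U) i then (1 : ℤ) else 0} := by
    rw [← lintegral_indicator_const hmu]
    refine lintegral_congr fun U => ?_
    by_cases h : c ≤ ∑ i ∈ Finset.range t, if muHit n d m (id, b, v, U) i then (1 : ℤ) else 0
    · rw [Set.indicator_of_mem (by exact h)]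
      simp only [h, Set.ofPred_true]
    · rw [Set.indicator_of_notMem (by exact h)]
      simp only [h, Set.ofPred_false, measure_empty]
  rw [hint, ← ENNReal.toReal_le_toReal (measure_ne_top _ _)
    (ENNReal.mul_ne_top (measure_ne_top _ _) (measure_ne_top _ _)), ENNReal.toReal_mul]
  exact measureReal_sum_etaHit_le m b v t c

end
end
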